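/- Let Ω ⊂ ℝ^N be a bounded domain with C^1 boundary and let u be a global minimizer of J in X which is a weak solution of the boundary value problem −div((g(|∇u|)/|∇u|)∇u) = f(u) in Ω, u = 0 on ∂Ω, and which satisfies ∂u/∂ν = 0 on ∂Ω (ν the exterior unit normal). Then u ≡ 0 in Ω. -/

import Mathlib

open Set Metric MeasureTheory Bornology
open scoped RealInnerProductSpace Classical

noncomputable section

/-- The vector field `y ↦ (g(|y|)/|y|)·y`, with the convention that it vanishes at `y = 0`. -/
def gvec {N : ℕ} (g : ℝ → ℝ) (y : EuclideanSpace ℝ (Fin N)) : EuclideanSpace ℝ (Fin N) :=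
  if y = 0 then 0 else (g ‖y‖ / ‖y‖) • y

/-- `φ` is a smooth test function compactly supported in `Ω`. -/
def IsTestFun {N : ℕ} (Ω : Set (EuclideanSpace ℝ (Fin N)))
    (φ : EuclideanSpace ℝ (Fin N) → ℝ) : Prop :=
  ContDiff ℝ (⊤ : ℕ∞) φ ∧ HasCompactSupport φ ∧ tsupport φ ⊆ Ω

/-- Conditions (2.1)-(2.2): `g ∈ C[0,∞) ∩ C¹(0,∞)`, `g(0) = 0`, `g'(t) > 0` for `t > 0`. -/
def GCond (g : ℝ → ℝ) : Prop :=
  ContinuousOn g (Ici 0) ∧ ContDiffOn ℝ 1 g (Ioi 0) ∧ g 0 = 0 ∧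
    ∀ t : ℝ, 0 < t → 0 < deriv g t

/-- Conditions (2.3)-(2.4): `f ∈ C([0,R] × [0,∞))`, `r ↦ f(r,t)` non-increasing. -/
def FCond (R : ℝ) (f : ℝ → ℝ → ℝ) : Prop :=
  ContinuousOn (fun q : ℝ × ℝ => f q.1 q.2) (Icc 0 R ×ˢ Ici 0) ∧
    ∀ t : ℝ, 0 ≤ t → ∀ r₁ ∈ Icc (0:ℝ) R, ∀ r₂ ∈ Icc (0:ℝ) R, r₁ ≤ r₂ → f r₂ t ≤ f r₁ t

/-- `u` solves `-div((g(|∇u|)/|∇u|)∇u) = f(|x|,u)` distributionally in the ball `B_R`. -/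
def IsDistribSolBall {N : ℕ} (R : ℝ) (g : ℝ → ℝ) (f : ℝ → ℝ → ℝ)
    (u : EuclideanSpace ℝ (Fin N) → ℝ) : Prop :=
  ∀ φ : EuclideanSpace ℝ (Fin N) → ℝ, IsTestFun (ball 0 R) φ →
    (∫ x in ball (0:EuclideanSpace ℝ (Fin N)) R, ⟪gvec g (gradient u x), gradient φ x⟫) =
      ∫ x in ball (0:EuclideanSpace ℝ (Fin N)) R, f ‖x‖ (u x) * φ x

/-- `u` is a weak solution of problem (P): `u ∈ C¹(clos B_R)`, `u ≥ 0`, `u ≢ 0`,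
`u = 0` on `∂B_R`, and the equation holds distributionally. -/
def IsWeakSolP {N : ℕ} (R : ℝ) (g : ℝ → ℝ) (f : ℝ → ℝ → ℝ)
    (u : EuclideanSpace ℝ (Fin N) → ℝ) : Prop :=
  ContDiffOn ℝ 1 u (closedBall 0 R) ∧
  (∀ x ∈ closedBall (0:EuclideanSpace ℝ (Fin N)) R, 0 ≤ u x) ∧
  (∃ x ∈ closedBall (0:EuclideanSpace ℝ (Fin N)) R, u x ≠ 0) ∧
  (∀ x ∈ sphere (0:EuclideanSpace ℝ (Fin N)) R, u x = 0) ∧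
  IsDistribSolBall R g f u

/-- `U` is `C¹` on `[a,b]` with (continuous) derivative `U'`. -/
def C1On (U U' : ℝ → ℝ) (a b : ℝ) : Prop :=
  ContinuousOn U' (Icc a b) ∧ ∀ r ∈ Icc a b, HasDerivWithinAt U (U' r) (Icc a b) r

/-- Definition 2.1: `u` is locally symmetric in `B_R`. -/
def LocallySymmetric {N : ℕ} (R : ℝ) (u : EuclideanSpace ℝ (Fin N) → ℝ) : Prop :=
  ∃ (K : Set ℕ) (z : ℕ → EuclideanSpace ℝ (Fin N)) (ri ro : ℕ → ℝ) (U U' : ℕ → ℝ → ℝ),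
    (∀ k ∈ K, z k ∈ ball (0:EuclideanSpace ℝ (Fin N)) R ∧ 0 ≤ ri k ∧ ri k < ro k) ∧
    K.PairwiseDisjoint (fun k => ball (z k) (ro k) \ closedBall (z k) (ri k)) ∧
    ball (0:EuclideanSpace ℝ (Fin N)) R =
      (⋃ k ∈ K, ball (z k) (ro k) \ closedBall (z k) (ri k)) ∪
        {x ∈ ball (0:EuclideanSpace ℝ (Fin N)) R | gradient u x = 0} ∧
    ∀ k ∈ K,
      C1On (U k) (U' k) (ri k) (ro k) ∧
      (∀ x ∈ ball (z k) (ro k) \ closedBall (z k) (ri k), u x = U k ‖x - z k‖) ∧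
      (∀ r ∈ Ioo (ri k) (ro k), U' k r < 0) ∧
      (∀ x ∈ ball (z k) (ri k), U k (ri k) ≤ u x)

/-- `H(t) = t·g(t) - ∫₀ᵗ g(s) ds`. -/
def Hfun (g : ℝ → ℝ) (t : ℝ) : ℝ := t * g t - ∫ s in (0:ℝ)..t, g s

/-- The inverse of `H` on `[0,∞)`. -/
def Hinv (g : ℝ → ℝ) : ℝ → ℝ := Function.invFunOn (Hfun g) (Ici 0)

/-- The class `A_g` of Definition 3.1. -/
def MemAg (g φ : ℝ → ℝ) : Prop :=
  ContinuousOn φ (Ici 0) ∧ (∀ t : ℝ, 0 ≤ t → 0 ≤ φ t) ∧ φ 0 = 0 ∧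
  ((∃ d > (0:ℝ), ∀ t ∈ Icc (0:ℝ) d, φ t = 0) ∨
    ∃ δ > (0:ℝ), (∀ t ∈ Ioo (0:ℝ) δ, 0 < φ t) ∧
      ∫⁻ t in Ioc (0:ℝ) δ, ENNReal.ofReal (1 / Hinv g (∫ s in (0:ℝ)..t, φ s)) = ⊤)

/-- `u` satisfies `div((g(|∇u|)/|∇u|)∇u) ≤ φ(u)` distributionally in `Ω`. -/
def DistribSupIneq {N : ℕ} (Ω : Set (EuclideanSpace ℝ (Fin N))) (g φ : ℝ → ℝ)
    (u : EuclideanSpace ℝ (Fin N) → ℝ) : Prop :=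
  ∀ ψ : EuclideanSpace ℝ (Fin N) → ℝ, IsTestFun Ω ψ → (∀ x, 0 ≤ ψ x) →
    -(∫ x in Ω, ⟪gvec g (gradient u x), gradient ψ x⟫) ≤ ∫ x in Ω, φ (u x) * ψ x

/-- Condition (a) of Lemma 3.7. -/
def CondA (R : ℝ) (g : ℝ → ℝ) (f : ℝ → ℝ → ℝ) : Prop :=
  ∀ ρ ∈ Ico (0:ℝ) R, ∀ τ : ℝ, 0 < τ → f ρ τ = 0 →
    ∃ δ ∈ Ioo (0:ℝ) τ, ∃ φ : ℝ → ℝ, MemAg g φ ∧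
      ∀ t ∈ Icc (τ - δ) τ, ∀ r ∈ Icc (ρ - δ) (ρ + δ) ∩ Icc (0:ℝ) R, f r t ≤ φ (τ - t)

/-- Condition (b) of Lemma 3.8. -/
def CondB (R : ℝ) (g : ℝ → ℝ) (f : ℝ → ℝ → ℝ) : Prop :=
  ∀ ρ ∈ Ico (0:ℝ) R, f ρ 0 = 0 →
    ∃ δ > (0:ℝ), ∃ φ : ℝ → ℝ, MemAg g φ ∧
      ∀ r ∈ Ico (0:ℝ) R, ∀ t ∈ Icc (0:ℝ) δ, -f r t ≤ φ t

/-- Condition (c) of Theorem 3.9. -/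
def CondC (R : ℝ) (g : ℝ → ℝ) (f : ℝ → ℝ → ℝ) : Prop :=
  ∀ ρ ∈ Ico (0:ℝ) R, ∀ τ : ℝ, 0 ≤ τ → f ρ τ = 0 →
    ∃ δ > (0:ℝ), ∃ φ : ℝ → ℝ, MemAg g φ ∧
      ∀ t ∈ Icc τ (τ + δ), ∀ r ∈ Icc (ρ - δ) (ρ + δ) ∩ Icc (0:ℝ) R, -f r t ≤ φ (t - τ)

/-- `u` solves `-div((g(|∇u|)/|∇u|)∇u) = f(u)` distributionally in `Ω` (autonomous case). -/
def IsDistribSolAut {N : ℕ} (Ω : Set (EuclideanSpace ℝ (Fin N))) (g f : ℝ → ℝ)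
    (u : EuclideanSpace ℝ (Fin N) → ℝ) : Prop :=
  ∀ φ : EuclideanSpace ℝ (Fin N) → ℝ, IsTestFun Ω φ →
    (∫ x in Ω, ⟪gvec g (gradient u x), gradient φ x⟫) = ∫ x in Ω, f (u x) * φ x

/-- `u` is a weak solution of problem (P) with autonomous right-hand side `f = f(u)`. -/
def IsWeakSolPAut {N : ℕ} (R : ℝ) (g f : ℝ → ℝ) (u : EuclideanSpace ℝ (Fin N) → ℝ) : Prop :=
  ContDiffOn ℝ 1 u (closedBall 0 R) ∧
  (∀ x ∈ closedBall (0:EuclideanSpace ℝ (Fin N)) R, 0 ≤ u x) ∧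
  (∃ x ∈ closedBall (0:EuclideanSpace ℝ (Fin N)) R, u x ≠ 0) ∧
  (∀ x ∈ sphere (0:EuclideanSpace ℝ (Fin N)) R, u x = 0) ∧
  IsDistribSolAut (ball 0 R) g f u

/-- `G(t) = ∫₀ᵗ g(s) ds`. -/
def Gfun (g : ℝ → ℝ) (t : ℝ) : ℝ := ∫ s in (0:ℝ)..t, g s

/-- The variational functional `J(v) = ∫_Ω (G(|∇v|) - F(v)) dx`. -/
def Jfun {N : ℕ} (g f : ℝ → ℝ) (Ω : Set (EuclideanSpace ℝ (Fin N)))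
    (v : EuclideanSpace ℝ (Fin N) → ℝ) : ℝ :=
  ∫ x in Ω, (Gfun g ‖gradient v x‖ - Gfun f (v x))

/-- `v ∈ X`, i.e. `v ∈ C¹(clos Ω)` with `v = 0` on `∂Ω`. -/
def MemX {N : ℕ} (Ω : Set (EuclideanSpace ℝ (Fin N)))
    (v : EuclideanSpace ℝ (Fin N) → ℝ) : Prop :=
  ContDiffOn ℝ 1 v (closure Ω) ∧ ∀ x ∈ frontier Ω, v x = 0

/-- `u` is a global minimizer of `J` in `X`. -/
def IsGlobalMinJ {N : ℕ} (g f : ℝ → ℝ) (Ω : Set (EuclideanSpace ℝ (Fin N)))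
    (u : EuclideanSpace ℝ (Fin N) → ℝ) : Prop :=
  MemX Ω u ∧ ∀ v, MemX Ω v → Jfun g f Ω u ≤ Jfun g f Ω v

/-- `u` is a local minimizer of `J` in `X` (w.r.t. the `C¹` distance). -/
def IsLocalMinJ {N : ℕ} (g f : ℝ → ℝ) (Ω : Set (EuclideanSpace ℝ (Fin N)))
    (u : EuclideanSpace ℝ (Fin N) → ℝ) : Prop :=
  MemX Ω u ∧ ∃ ε > (0:ℝ), ∀ v, MemX Ω v →
    (∀ x ∈ Ω, |v x - u x| + ‖gradient v x - gradient u x‖ < ε) →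
    Jfun g f Ω u ≤ Jfun g f Ω v

/-- `Ω` has `C¹` boundary: near every boundary point, `Ω` is the sublevel set of a `C¹`
defining function with nonvanishing gradient. -/
def HasC1Boundary {N : ℕ} (Ω : Set (EuclideanSpace ℝ (Fin N))) : Prop :=
  ∀ y ∈ frontier Ω, ∃ (V : Set (EuclideanSpace ℝ (Fin N))) (ρ : EuclideanSpace ℝ (Fin N) → ℝ),
    IsOpen V ∧ y ∈ V ∧ ContDiffOn ℝ 1 ρ V ∧ (∀ x ∈ V, (x ∈ Ω ↔ ρ x < 0)) ∧ gradient ρ y ≠ 0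

/-- The Neumann condition `∂u/∂ν = 0` on `∂Ω`; for `u ∈ X` (so that `u` vanishes on the
boundary and all tangential derivatives vanish) this is equivalent to the vanishing of the
full derivative of `u` (within `clos Ω`) at every boundary point. -/
def NeumannZero {N : ℕ} (Ω : Set (EuclideanSpace ℝ (Fin N)))
    (u : EuclideanSpace ℝ (Fin N) → ℝ) : Prop :=
  ∀ y ∈ frontier Ω, HasFDerivWithinAt u (0 : EuclideanSpace ℝ (Fin N) →L[ℝ] ℝ) (closure Ω) y

/-- `u` is radially symmetric and radially non-increasing on `clos B_R`, with `C¹`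
profile `U` (with derivative `U'`). -/
def RadialNonincreasing {N : ℕ} (R : ℝ) (u : EuclideanSpace ℝ (Fin N) → ℝ)
    (U U' : ℝ → ℝ) : Prop :=
  C1On U U' 0 R ∧ AntitoneOn U (Icc 0 R) ∧
    ∀ x ∈ closedBall (0:EuclideanSpace ℝ (Fin N)) R, u x = U ‖x‖

end


/-- Extension by zero of `u` is `C¹`. -/
lemma ext_contDiff {N : ℕ} {Ω : Set (EuclideanSpace ℝ (Fin N))}
    (hΩo : IsOpen Ω) (hΩbd : HasC1Boundary Ω)
    {u : EuclideanSpace ℝ (Fin N) → ℝ} (hX : MemX Ω u) (hneu : NeumannZero Ω u) :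
    ContDiff ℝ 1 (Ω.indicator u) := by
  have hwu : ∀ x ∈ closure Ω, Ω.indicator u x = u x := by
    intro x hx
    by_cases h : x ∈ Ω
    · simp [h]
    · have : x ∈ frontier Ω := by rw [hΩo.frontier_eq]; exact ⟨hx, h⟩
      simp [h, hX.2 x this]
  have hfr : ∀ y ∈ frontier Ω, HasFDerivAt (Ω.indicator u) (0 : _ →L[ℝ] ℝ) y := by
    intro y hy
    have hyc : y ∈ closure Ω := frontier_subset_closure hy
    have h1 : HasFDerivWithinAt (Ω.indicator u) (0 : _ →L[ℝ] ℝ) (closure Ω) y :=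
      (hneu y hy).congr hwu (hwu y hyc)
    have h2 : HasFDerivWithinAt (Ω.indicator u) (0 : _ →L[ℝ] ℝ) (closure Ω)ᶜ y := by
      refine (hasFDerivWithinAt_const (0:ℝ) y _).congr ?_ ?_
      · intro x hx
        exact indicator_of_notMem (fun h => hx (subset_closure h)) _
      · rw [hwu y hyc, hX.2 y hy]
    have := h1.union h2
    rwa [union_compl_self, hasFDerivWithinAt_univ] at this
  have hin : ∀ x ∈ Ω, Ω.indicator u =ᶠ[nhds x] u := by
    intro x hx
    filter_upwards [hΩo.mem_nhds hx] with z hz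
    simp [hz]
  have hout : ∀ x ∉ closure Ω, Ω.indicator u =ᶠ[nhds x] fun _ => 0 := by
    intro x hx
    filter_upwards [isClosed_closure.isOpen_compl.mem_nhds hx] with z hz
    exact indicator_of_notMem (fun h => hz (subset_closure h)) _
  have hcl : ∀ x ∈ Ω, ContDiffAt ℝ 1 u x := fun x hx =>
    (hX.1 x (subset_closure hx)).contDiffAt
      (Filter.mem_of_superset (hΩo.mem_nhds hx) subset_closure)
  rw [contDiff_iff_contDiffAt]
  intro y
  by_cases hyΩ : y ∈ Ω
  · exact (hcl y hyΩ).congr_of_eventuallyEq (hin y hyΩ)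
  by_cases hyc : y ∈ closure Ω
  swap
  · exact contDiffAt_const.congr_of_eventuallyEq (hout y hyc)
  have hy : y ∈ frontier Ω := by rw [hΩo.frontier_eq]; exact ⟨hyc, hyΩ⟩
  -- differentiability everywhere
  have hdiff : Differentiable ℝ (Ω.indicator u) := by
    intro x
    by_cases hxΩ : x ∈ Ω
    · exact ((hcl x hxΩ).differentiableAt one_ne_zero).congr_of_eventuallyEq (hin x hxΩ)
    by_cases hxc : x ∈ closure Ω
    · exact (hfr x (by rw [hΩo.frontier_eq]; exact ⟨hxc, hxΩ⟩)).differentiableAt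
    · exact (differentiableAt_const (0:ℝ)).congr_of_eventuallyEq (hout x hxc)
  have hcont : ∀ x, ContinuousAt (fderiv ℝ (Ω.indicator u)) x := by
    intro x
    by_cases hxΩ : x ∈ Ω
    · exact (((hcl x hxΩ).congr_of_eventuallyEq (hin x hxΩ)).fderiv_right
        (m := 0) (by norm_num)).continuousAt
    by_cases hxc : x ∈ closure Ω
    swap
    · exact (((contDiffAt_const (n := 1)).congr_of_eventuallyEq (hout x hxc)).fderiv_right
        (m := 0) (by norm_num)).continuousAt
    have hx : x ∈ frontier Ω := by rw [hΩo.frontier_eq]; exact ⟨hxc, hxΩ⟩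
    have h1 : ContDiffWithinAt ℝ (0 + 1) u (closure Ω) x := by simpa using hX.1 x hxc
    rw [contDiffWithinAt_succ_iff_hasFDerivWithinAt (by simp)] at h1
    obtain ⟨W, hW, -, p, hp, hpc⟩ := h1
    rw [insert_eq_of_mem hxc] at hW
    have hxW : x ∈ W := mem_of_mem_nhdsWithin hxc hW
    obtain ⟨O, hOo, hxO, hOW⟩ := mem_nhdsWithin.1 hW
    -- `p x = 0`
    have hp0 : p x = 0 := by
      obtain ⟨V, ρ, hVo, hxV, hρ, hρΩ, hgr⟩ := hΩbd x hx
      have hρd : DifferentiableAt ℝ ρ x :=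
        (hρ.contDiffAt (hVo.mem_nhds hxV)).differentiableAt one_ne_zero
      have hρx : 0 ≤ ρ x := by
        by_contra h
        exact hxΩ ((hρΩ x hxV).2 (not_le.1 h))
      have hρx' : ρ x ≤ 0 := by
        have hc : ContinuousAt ρ x := hρd.continuousAt
        have hf : ∃ᶠ z in nhds x, ρ z ≤ 0 := by
          have := mem_closure_iff_frequently.1 hxc
          refine (this.and_eventually (hVo.mem_nhds hxV)).mono ?_
          rintro z ⟨hz, hzV⟩
          exact ((hρΩ z hzV).1 hz).le
        by_contra h
        exact hf ((hc.eventually (lt_mem_nhds (not_le.1 h))).mono fun z hz => not_le.2 hz)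
      have hρ0 : ρ x = 0 := le_antisymm hρx' hρx
      have key : ∀ d, fderiv ℝ ρ x d < 0 → p x d = 0 := by
        intro d hd
        have hline : HasDerivAt (fun s : ℝ => x + s • d) d 0 := by
          simpa using ((hasDerivAt_id (0:ℝ)).smul_const d).const_add x
        have hρl : HasDerivAt (fun s : ℝ => ρ (x + s • d)) (fderiv ℝ ρ x d) 0 := by
          have h' : HasFDerivAt ρ (fderiv ℝ ρ x) (x + (0:ℝ) • d) := by simpa using hρd.hasFDerivAt
          exact h'.comp_hasDerivAt (0:ℝ) hline
        have hcl : ContinuousAt (fun s : ℝ => x + s • d) 0 := hline.continuousAt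
        have hev : ∀ᶠ s in nhdsWithin (0:ℝ) (Ioi 0), x + s • d ∈ W ∩ closure Ω := by
          have h1 : ∀ᶠ s in nhdsWithin (0:ℝ) (Ioi 0), ρ (x + s • d) < 0 := by
            have := hρl.hasDerivWithinAt (s := Ioi 0)
            have := (hasDerivWithinAt_iff_tendsto_slope' (by simp)).1 this
            have := this.eventually (gt_mem_nhds hd)
            filter_upwards [this, self_mem_nhdsWithin] with s hs hs0
            simp only [slope_def_field, zero_smul, add_zero, hρ0, sub_zero] at hs
            have hs0 : 0 < s := hs0
            rw [div_lt_iff₀ hs0, zero_mul] at hs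
            exact hs
          have h2 : ∀ᶠ s in nhdsWithin (0:ℝ) (Ioi 0), x + s • d ∈ V ∩ O := by
            refine (hcl.eventually ?_).filter_mono nhdsWithin_le_nhds
            simp only [zero_smul, add_zero]
            exact (hVo.inter hOo).mem_nhds ⟨hxV, hxO⟩
          filter_upwards [h1, h2] with s hs1 hs2
          have : x + s • d ∈ closure Ω := subset_closure ((hρΩ _ hs2.1).2 hs1)
          exact ⟨hOW ⟨hs2.2, this⟩, this⟩
        have aux : ∀ (A : EuclideanSpace ℝ (Fin N) →L[ℝ] ℝ) (S : Set _),
            HasFDerivWithinAt u A S x → W ∩ closure Ω ⊆ S →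
            Filter.Tendsto (slope (fun s : ℝ => u (x + s • d)) 0)
              (nhdsWithin (0:ℝ) (Ioi 0)) (nhds (A d)) := by
          intro A S hA hS
          obtain ⟨ε, hε, hεs⟩ : ∃ ε > (0:ℝ), ∀ s ∈ Ioo 0 ε, x + s • d ∈ S := by
            obtain ⟨ε, hε, h⟩ := (mem_nhdsGT_iff_exists_Ioo_subset.1 hev)
            exact ⟨ε, hε, fun s hs => hS (h hs)⟩
          have h' : HasFDerivWithinAt u A S (x + (0:ℝ) • d) := by simpa using hA
          have := h'.comp_hasDerivWithinAt (0:ℝ) (s := Ioo 0 ε) hline.hasDerivWithinAt hεs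
          have := (hasDerivWithinAt_iff_tendsto_slope' (by simp)).1 this
          rwa [nhdsWithin_Ioo_eq_nhdsGT hε] at this
        have t1 := aux _ _ (hp x hxW) inter_subset_left
        have t2 := aux _ _ (hneu x hx) inter_subset_right
        simpa using tendsto_nhds_unique t1 t2
      have hne : fderiv ℝ ρ x ≠ 0 := by
        intro h
        apply hgr
        simp [gradient, h]
      obtain ⟨d, hd⟩ : ∃ d, fderiv ℝ ρ x d < 0 := by
        by_contra! h
        apply hne
        ext d
        have := h d
        have h2 := h (-d)
        simp only [map_neg] at h2
        simp only [ContinuousLinearMap.zero_apply]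
        linarith
      ext c
      -- `c = (c + k d) - k d`
      obtain ⟨k, hk, hk2⟩ : ∃ k : ℝ, 0 < k ∧ fderiv ℝ ρ x (c + k • d) < 0 := by
        refine ⟨|fderiv ℝ ρ x c| / (-fderiv ℝ ρ x d) + 1, ?_, ?_⟩
        · have : 0 < -fderiv ℝ ρ x d := by linarith
          positivity
        · have h3 : 0 < -fderiv ℝ ρ x d := by linarith
          simp only [map_add, map_smul, smul_eq_mul]
          have : |fderiv ℝ ρ x c| / (-fderiv ℝ ρ x d) * fderiv ℝ ρ x d = -|fderiv ℝ ρ x c| := by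
            have : fderiv ℝ ρ x d ≠ 0 := by linarith
            field_simp
          rw [add_mul, this]
          have := le_abs_self (fderiv ℝ ρ x c)
          linarith
      have e1 := key _ hk2
      have e2 := key _ hd
      simp only [map_add, map_smul, e2, smul_zero, add_zero] at e1
      simpa using e1
    have hfx : fderiv ℝ (Ω.indicator u) x = 0 := (hfr x hx).fderiv
    have hpt : Filter.Tendsto p (nhdsWithin x W) (nhds 0) := by
      rw [← hp0]; exact hpc.continuousWithinAt
    rw [ContinuousAt, hfx, Metric.tendsto_nhds]
    intro ε hε
    have hpe := (Metric.tendsto_nhds.1 hpt) ε hε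
    have hpe2 : ∀ᶠ z in nhds x, z ∈ W → dist (p z) 0 < ε := eventually_nhdsWithin_iff.1 hpe
    filter_upwards [hpe2, hOo.mem_nhds hxO] with z hz hzO
    by_cases hzΩ : z ∈ Ω
    · have hzW : W ∈ nhds z := by
        filter_upwards [hOo.mem_nhds hzO, hΩo.mem_nhds hzΩ] with q hq hq2
        exact hOW ⟨hq, subset_closure hq2⟩
      have hd : HasFDerivAt u (p z) z :=
        (hp z (mem_of_mem_nhds hzW)).hasFDerivAt hzW
      rw [(hd.congr_of_eventuallyEq (hin z hzΩ)).fderiv]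
      exact hz (mem_of_mem_nhds hzW)
    by_cases hzc : z ∈ closure Ω
    · rw [(hfr z (by rw [hΩo.frontier_eq]; exact ⟨hzc, hzΩ⟩)).fderiv]
      simpa using hε
    · rw [(hout z hzc).fderiv_eq]
      simpa using hε
  exact (contDiff_one_iff_fderiv.2 ⟨hdiff, continuous_iff_continuousAt.2 hcont⟩).contDiffAt


lemma integrable_clm_apply' {N : ℕ} {A : EuclideanSpace ℝ (Fin N) → EuclideanSpace ℝ (Fin N) →L[ℝ] ℝ}
    {T : EuclideanSpace ℝ (Fin N) → EuclideanSpace ℝ (Fin N)} (hA : Continuous A) {K : ℝ}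
    (hK : ∀ x, T x ≠ 0 → ‖A x‖ ≤ K) (hT : Integrable T) : Integrable (fun x => A x (T x)) := by
  refine (hT.norm.const_mul K).mono' ?_ ?_
  · exact isBoundedBilinearMap_apply.continuous.comp_aestronglyMeasurable
      (hA.aestronglyMeasurable.prodMk hT.aestronglyMeasurable)
  · filter_upwards with x
    by_cases h : T x = 0
    · simp [h]
    · exact ((A x).le_opNorm _).trans (mul_le_mul_of_nonneg_right (hK x h) (norm_nonneg _))

set_option maxHeartbeats 800000 in
lemma bdry_core {N : ℕ} {Ω : Set (EuclideanSpace ℝ (Fin N))} (hΩo : IsOpen Ω)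
    {T : EuclideanSpace ℝ (Fin N) → EuclideanSpace ℝ (Fin N)}
    (hTi : Integrable T) (hT0 : ∀ x ∉ Ω, T x = 0)
    (hTc : ∀ x ∈ frontier Ω, ContinuousAt T x)
    (hT : ∀ φ : EuclideanSpace ℝ (Fin N) → ℝ, ContDiff ℝ 1 φ → HasCompactSupport φ →
      tsupport φ ⊆ Ω → ∫ x, fderiv ℝ φ x (T x) = 0)
    (y d : EuclideanSpace ℝ (Fin N)) {r C : ℝ} (hr : 0 < r) {ρ : EuclideanSpace ℝ (Fin N) → ℝ}
    (hρ : ContDiff ℝ 1 ρ) (hρΩ : ∀ x ∈ closedBall y r, (x ∈ Ω ↔ ρ x < 0))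
    (hd : ∀ x ∈ closedBall y r, 1 / 2 ≤ fderiv ℝ ρ x d)
    (hC : ∀ x ∈ closedBall y r, ‖fderiv ℝ ρ x‖ ≤ C)
    (χ : ContDiffBump y) (hχr : χ.rOut = r)
    (φ : EuclideanSpace ℝ (Fin N) → ℝ) (hφ : ContDiff ℝ 1 φ) :
    ∫ x, fderiv ℝ (fun z => χ z * φ z) x (T x) = 0 := by
  have hC0 : 0 ≤ C := (norm_nonneg _).trans (hC y (mem_closedBall_self hr.le))
  have hχc : ContDiff ℝ 1 (fun z => χ z) := χ.contDiff
  have hχcs : HasCompactSupport (fun z => χ z) := χ.hasCompactSupport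
  have hχoff : ∀ x ∉ closedBall y r, χ x = 0 := by
    intro x hx
    refine χ.zero_of_le_dist ?_
    rw [hχr]
    exact (not_le.1 hx).le
  have hχφ : ContDiff ℝ 1 (fun z => χ z * φ z) := hχc.mul hφ
  have hχφs : HasCompactSupport (fun z => χ z * φ z) := hχcs.mul_right
  have hsm : ContDiff ℝ 1 Real.smoothTransition := Real.smoothTransition.contDiff
  have hs' : ∀ t, 0 ≤ deriv Real.smoothTransition t := fun t =>
    Real.smoothTransition.monotone.deriv_nonneg
  have hs1 : ∀ t, deriv Real.smoothTransition t ≠ 0 → t ≤ 1 := by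
    intro t ht
    by_contra h
    apply ht
    have : Real.smoothTransition =ᶠ[nhds t] fun _ => 1 := by
      filter_upwards [lt_mem_nhds (not_le.1 h)] with z hz
      exact Real.smoothTransition.one_of_one_le hz.le
    rw [this.deriv_eq]; simp
  set H : ℝ → EuclideanSpace ℝ (Fin N) → ℝ :=
    fun ε x => Real.smoothTransition (-1 - ρ x / ε) with hH
  have hHc : ∀ ε, ContDiff ℝ 1 (H ε) := fun ε =>
    hsm.comp (contDiff_const.sub (hρ.div_const ε))
  have hH01 : ∀ ε x, 0 ≤ H ε x ∧ H ε x ≤ 1 := fun ε x =>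
    ⟨Real.smoothTransition.nonneg _, Real.smoothTransition.le_one _⟩
  have hHd : ∀ ε x, fderiv ℝ (H ε) x =
      -(deriv Real.smoothTransition (-1 - ρ x / ε) / ε) • fderiv ℝ ρ x := by
    intro ε x
    have h1 : HasFDerivAt ρ (fderiv ℝ ρ x) x := (hρ.differentiable one_ne_zero x).hasFDerivAt
    have h2 : HasFDerivAt (fun x => -1 - ρ x / ε) (-((ε⁻¹) • fderiv ℝ ρ x)) x := by
      have := (h1.const_mul ε⁻¹).const_sub (-1)
      simpa [div_eq_inv_mul] using this
    have h3 := ((hsm.differentiable one_ne_zero _).hasDerivAt (x := -1 - ρ x / ε)).comp_hasFDerivAt x h2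
    have h4 := h3.fderiv
    have h5 : (Real.smoothTransition ∘ fun x => -1 - ρ x / ε) = H ε := rfl
    rw [h5] at h4
    rw [h4]
    ext v
    simp
    ring
  have hcsb : ∀ (A : EuclideanSpace ℝ (Fin N) → EuclideanSpace ℝ (Fin N) →L[ℝ] ℝ),
      Continuous A → HasCompactSupport A → Integrable (fun x => A x (T x)) := by
    intro A hA hAs
    obtain ⟨K, hK⟩ := hA.bounded_above_of_compact_support hAs
    exact integrable_clm_apply' hA (fun x _ => hK x) hTi
  obtain ⟨M, hM⟩ : ∃ M, ∀ x ∈ closedBall y r, ‖φ x‖ ≤ M :=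
    (isCompact_closedBall y r).exists_bound_of_continuousOn hφ.continuous.continuousOn
  have hM0 : 0 ≤ M := (norm_nonneg _).trans (hM y (mem_closedBall_self hr.le))
  set D := ∫ x, |fderiv ℝ (fun z => χ z) x d| with hD
  have hfχc : Continuous (fun x => fderiv ℝ (fun z => χ z) x d) :=
    (hχc.continuous_fderiv one_ne_zero).clm_apply continuous_const
  have hfχi : Integrable (fun x => fderiv ℝ (fun z => χ z) x d) := by
    refine hfχc.integrable_of_hasCompactSupport ?_
    exact (hχcs.fderiv ℝ).comp_left (g := fun L : EuclideanSpace ℝ (Fin N) →L[ℝ] ℝ => L d) (by simp)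
  have hIBP : ∀ ε > 0, ∫ x, χ x * (-(fderiv ℝ (H ε) x d)) ≤ D := by
    intro ε hε
    have i1 : Integrable (fun x => fderiv ℝ (fun z => χ z) x d * H ε x) := by
      refine hfχi.mul_bdd (c := 1) (hHc ε).continuous.aestronglyMeasurable ?_
      filter_upwards with x
      rw [Real.norm_of_nonneg (hH01 ε x).1]; exact (hH01 ε x).2
    have i2 : Integrable (fun x => χ x * fderiv ℝ (H ε) x d) := by
      refine (hχc.continuous.mul (((hHc ε).continuous_fderiv one_ne_zero).clm_apply
        continuous_const)).integrable_of_hasCompactSupport ?_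
      exact hχcs.mul_right
    have i3 : Integrable (fun x => χ x * H ε x) :=
      (hχc.continuous.mul (hHc ε).continuous).integrable_of_hasCompactSupport hχcs.mul_right
    have := integral_mul_fderiv_eq_neg_fderiv_mul_of_integrable (μ := volume) i1 i2 i3
      (fun x _ => hχc.differentiable one_ne_zero x) (fun x _ => (hHc ε).differentiable one_ne_zero x)
    simp only [mul_neg, integral_neg]
    rw [this, neg_neg]
    refine integral_mono i1 hfχi.abs fun x => ?_
    calc fderiv ℝ (fun z => χ z) x d * H ε x ≤ |fderiv ℝ (fun z => χ z) x d| * H ε x :=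
          mul_le_mul_of_nonneg_right (le_abs_self _) (hH01 ε x).1
      _ ≤ |fderiv ℝ (fun z => χ z) x d| * 1 :=
          mul_le_mul_of_nonneg_left (hH01 ε x).2 (abs_nonneg _)
      _ = _ := mul_one _
  -- main estimate
  have hmain : ∀ δ > 0, ∀ᶠ ε in nhdsWithin (0:ℝ) (Ioi 0),
      ‖∫ x, H ε x * fderiv ℝ (fun z => χ z * φ z) x (T x)‖ ≤ δ * (M * (2 * C) * D) := by
    intro δ hδ
    obtain ⟨η, hη, hηT⟩ : ∃ η > (0:ℝ), ∀ x ∈ closedBall y r, x ∈ Ω → -η < ρ x → ‖T x‖ ≤ δ := by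
      set K' := (closedBall y r ∩ closure Ω) \ interior {x | ‖T x‖ < δ} with hK'
      have hK'c : IsCompact K' :=
        ((isCompact_closedBall y r).inter_right isClosed_closure).diff isOpen_interior
      have hK'Ω : ∀ x ∈ K', ρ x < 0 := by
        intro x hx
        by_contra h
        have hxΩ : x ∉ Ω := fun h' => h ((hρΩ x hx.1.1).1 h')
        have hxf : x ∈ frontier Ω := by rw [hΩo.frontier_eq]; exact ⟨hx.1.2, hxΩ⟩
        apply hx.2
        rw [mem_interior_iff_mem_nhds]
        have := (hTc x hxf).norm
        refine this.eventually (gt_mem_nhds ?_)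
        simpa [hT0 x hxΩ] using hδ
      rcases K'.eq_empty_or_nonempty with he | hne
      · refine ⟨1, one_pos, fun x hx hxΩ _ => ?_⟩
        by_contra h
        have : x ∈ K' := ⟨⟨hx, subset_closure hxΩ⟩, fun h' => by
          have h2 : x ∈ {x | ‖T x‖ < δ} := interior_subset h'
          have h2 : ‖T x‖ < δ := h2
          exact h h2.le⟩
        rw [he] at this; exact this
      · obtain ⟨z, hz, hzm⟩ := hK'c.exists_isMaxOn hne hρ.continuous.continuousOn
        refine ⟨-ρ z, by linarith [hK'Ω z hz], fun x hx hxΩ hxη => ?_⟩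
        by_contra h
        have : x ∈ K' := ⟨⟨hx, subset_closure hxΩ⟩, fun h' => by
          have h2 : x ∈ {x | ‖T x‖ < δ} := interior_subset h'
          have h2 : ‖T x‖ < δ := h2
          exact h h2.le⟩
        have := hzm this
        simp only [mem_ofPred_eq] at this
        linarith
    have hev : ∀ᶠ ε in nhdsWithin (0:ℝ) (Ioi 0), ε < η / 2 :=
      nhdsWithin_le_nhds (gt_mem_nhds (by positivity))
    filter_upwards [hev, self_mem_nhdsWithin] with ε hε1 hε
    have hε : 0 < ε := hε
    -- product test function
    have hψc : ContDiff ℝ 1 (fun z => (χ z * φ z) * H ε z) := hχφ.mul (hHc ε)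
    have hψt : tsupport (fun z => (χ z * φ z) * H ε z) ⊆ closedBall y r ∩ {x | ρ x ≤ -ε} := by
      refine closure_minimal ?_ (isClosed_closedBall.inter (isClosed_le hρ.continuous continuous_const))
      intro x hx
      constructor
      · by_contra h
        exact hx (by simp [hχoff x h])
      · by_contra h
        apply hx
        have : H ε x = 0 := by
          apply Real.smoothTransition.zero_of_nonpos
          have h : -ε < ρ x := not_le.1 h
          have : -1 < ρ x / ε := by rw [lt_div_iff₀ hε]; linarith
          linarith
        simp [this]
    have hzero := hT _ hψc hχφs.mul_right (fun x hx => by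
      have := hψt hx
      refine (hρΩ x this.1).2 ?_
      have h2 : ρ x ≤ -ε := this.2
      linarith)
    have hprod : ∀ x, fderiv ℝ (fun z => (χ z * φ z) * H ε z) x (T x) =
        H ε x * fderiv ℝ (fun z => χ z * φ z) x (T x) + (χ x * φ x) * fderiv ℝ (H ε) x (T x) := by
      intro x
      rw [fderiv_fun_mul (hχφ.differentiable one_ne_zero x) ((hHc ε).differentiable one_ne_zero x)]
      simp
      ring
    have j1 : Integrable (fun x => H ε x * fderiv ℝ (fun z => χ z * φ z) x (T x)) := by
      refine hcsb (fun x => H ε x • fderiv ℝ (fun z => χ z * φ z) x) ?_ ?_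
      · exact (hHc ε).continuous.smul (hχφ.continuous_fderiv one_ne_zero)
      · exact HasCompactSupport.smul_left (f := H ε) (f' := fderiv ℝ (fun z => χ z * φ z)) (hχφs.fderiv ℝ)
    have j2 : Integrable (fun x => (χ x * φ x) * fderiv ℝ (H ε) x (T x)) := by
      refine hcsb (fun x => (χ x * φ x) • fderiv ℝ (H ε) x) ?_ ?_
      · exact hχφ.continuous.smul ((hHc ε).continuous_fderiv one_ne_zero)
      · exact HasCompactSupport.smul_right (f := fun x => χ x * φ x) (f' := fderiv ℝ (H ε)) hχφs
    simp_rw [hprod] at hzero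
    rw [integral_add j1 j2] at hzero
    rw [eq_neg_of_add_eq_zero_left hzero, norm_neg]
    have j3 : Integrable (fun x => χ x * (-(fderiv ℝ (H ε) x d))) := by
      refine (hχc.continuous.mul (((hHc ε).continuous_fderiv one_ne_zero).clm_apply
        continuous_const).neg).integrable_of_hasCompactSupport ?_
      exact hχcs.mul_right
    calc ‖∫ x, (χ x * φ x) * fderiv ℝ (H ε) x (T x)‖
        ≤ ∫ x, (δ * (M * (2 * C))) * (χ x * (-(fderiv ℝ (H ε) x d))) := by
          refine norm_integral_le_of_norm_le (j3.const_mul _) ?_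
          filter_upwards with x
          by_cases hx : x ∈ closedBall y r
          swap
          · simp [hχoff x hx]
          have hχ0 : 0 ≤ χ x := χ.nonneg
          have key : ‖fderiv ℝ (H ε) x (T x)‖ ≤ δ * (2 * C) * (-(fderiv ℝ (H ε) x d)) := by
            rw [hHd]
            set a := deriv Real.smoothTransition (-1 - ρ x / ε) / ε with ha
            have ha0 : 0 ≤ a := div_nonneg (hs' _) hε.le
            simp only [neg_smul, neg_apply, smul_apply, smul_eq_mul,
              neg_neg, norm_neg, norm_mul, Real.norm_of_nonneg ha0]
            have hTd : a = 0 ∨ ‖T x‖ ≤ δ := by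
              by_cases h0 : deriv Real.smoothTransition (-1 - ρ x / ε) = 0
              · left; rw [ha, h0, zero_div]
              · right
                by_cases hxΩ : x ∈ Ω
                · refine hηT x hx hxΩ ?_
                  have := hs1 _ h0
                  have h3 : -2 ≤ ρ x / ε := by linarith
                  rw [le_div_iff₀ hε] at h3
                  linarith
                · rw [hT0 x hxΩ]; simpa using hδ.le
            rcases hTd with h | h
            · rw [h]; simp
            · have h1 := (fderiv ℝ ρ x).le_opNorm (T x)
              have h2 : ‖fderiv ℝ ρ x‖ * ‖T x‖ ≤ C * δ :=
                mul_le_mul (hC x hx) h (norm_nonneg _) hC0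
              have h3 := hd x hx
              have h4 : C * δ ≤ δ * (2 * C) * fderiv ℝ ρ x d := by
                have : 0 ≤ C * δ := mul_nonneg hC0 hδ.le
                nlinarith
              calc a * ‖fderiv ℝ ρ x (T x)‖ ≤ a * (δ * (2 * C) * fderiv ℝ ρ x d) :=
                    mul_le_mul_of_nonneg_left (h1.trans (h2.trans h4)) ha0
                _ = _ := by ring
          rw [norm_mul, norm_mul, Real.norm_of_nonneg hχ0]
          calc χ x * ‖φ x‖ * ‖fderiv ℝ (H ε) x (T x)‖
              ≤ χ x * M * (δ * (2 * C) * (-(fderiv ℝ (H ε) x d))) := by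
                refine mul_le_mul (mul_le_mul_of_nonneg_left (hM x hx) hχ0) key (norm_nonneg _)
                  (mul_nonneg hχ0 hM0)
            _ = _ := by ring
      _ = (δ * (M * (2 * C))) * ∫ x, (χ x * (-(fderiv ℝ (H ε) x d))) := integral_const_mul _ _
      _ ≤ (δ * (M * (2 * C))) * D :=
          mul_le_mul_of_nonneg_left (hIBP ε hε) (by positivity)
      _ = _ := by ring
  -- limit
  have hlim : Filter.Tendsto (fun ε => ∫ x, H ε x * fderiv ℝ (fun z => χ z * φ z) x (T x))
      (nhdsWithin (0:ℝ) (Ioi 0)) (nhds (∫ x, fderiv ℝ (fun z => χ z * φ z) x (T x))) := by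
    have jj : Integrable (fun x => fderiv ℝ (fun z => χ z * φ z) x (T x)) :=
      hcsb _ (hχφ.continuous_fderiv one_ne_zero) (hχφs.fderiv ℝ)
    refine tendsto_integral_filter_of_dominated_convergence
      (fun x => ‖fderiv ℝ (fun z => χ z * φ z) x (T x)‖) ?_ ?_ jj.norm ?_
    · filter_upwards with ε
      exact (hHc ε).continuous.aestronglyMeasurable.mul jj.aestronglyMeasurable
    · filter_upwards with ε
      filter_upwards with x
      rw [norm_mul, Real.norm_of_nonneg (hH01 ε x).1]
      exact mul_le_of_le_one_left (norm_nonneg _) (hH01 ε x).2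
    · filter_upwards with x
      by_cases hxΩ : x ∈ Ω
      swap
      · simp [hT0 x hxΩ]
      by_cases hx : x ∈ closedBall y r
      · have hρx := (hρΩ x hx).1 hxΩ
        refine tendsto_const_nhds.congr' ?_
        have hev : ∀ᶠ ε in nhdsWithin (0:ℝ) (Ioi 0), ε < -ρ x / 2 :=
          nhdsWithin_le_nhds (gt_mem_nhds (by linarith))
        filter_upwards [hev, self_mem_nhdsWithin] with ε hε1 hε
        have hε : 0 < ε := hε
        have : H ε x = 1 := by
          apply Real.smoothTransition.one_of_one_le
          have : ρ x / ε ≤ -2 := by rw [div_le_iff₀ hε]; linarith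
          linarith
        rw [this, one_mul]
      · have : (fun z => χ z * φ z) =ᶠ[nhds x] fun _ => 0 := by
          filter_upwards [isClosed_closedBall.isOpen_compl.mem_nhds hx] with z hz
          simp [hχoff z hz]
        rw [this.fderiv_eq]
        simp
  have hfin : ∀ δ > 0, ‖∫ x, fderiv ℝ (fun z => χ z * φ z) x (T x)‖ ≤ δ * (M * (2 * C) * D) :=
    fun δ hδ => le_of_tendsto hlim.norm (hmain δ hδ)
  have ht : Filter.Tendsto (fun δ : ℝ => δ * (M * (2 * C) * D)) (nhdsWithin 0 (Ioi 0)) (nhds 0) := by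
    have : Filter.Tendsto (fun δ : ℝ => δ * (M * (2 * C) * D)) (nhds 0) (nhds (0 * (M * (2 * C) * D))) :=
      (continuous_id.mul continuous_const).tendsto 0
    rw [zero_mul] at this
    exact this.mono_left nhdsWithin_le_nhds
  have := ge_of_tendsto ht (by filter_upwards [self_mem_nhdsWithin] with δ hδ using hfin δ hδ)
  exact norm_le_zero_iff.1 this


set_option maxHeartbeats 800000 in
lemma bdry_local {N : ℕ} {Ω : Set (EuclideanSpace ℝ (Fin N))} (hΩo : IsOpen Ω)
    (hΩbd : HasC1Boundary Ω)
    {T : EuclideanSpace ℝ (Fin N) → EuclideanSpace ℝ (Fin N)}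
    (hTi : Integrable T) (hT0 : ∀ x ∉ Ω, T x = 0)
    (hTc : ∀ x ∈ frontier Ω, ContinuousAt T x)
    (hT : ∀ φ : EuclideanSpace ℝ (Fin N) → ℝ, ContDiff ℝ 1 φ → HasCompactSupport φ →
      tsupport φ ⊆ Ω → ∫ x, fderiv ℝ φ x (T x) = 0)
    (y : EuclideanSpace ℝ (Fin N)) (hy : y ∈ frontier Ω) :
    ∃ χ : ContDiffBump y, ∀ φ : EuclideanSpace ℝ (Fin N) → ℝ, ContDiff ℝ 1 φ →
      ∫ x, fderiv ℝ (fun z => χ z * φ z) x (T x) = 0 := by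
  obtain ⟨V, ρ, hVo, hyV, hρ, hρΩ, hgr⟩ := hΩbd y hy
  obtain ⟨r0, hr0, hr0V⟩ := Metric.nhds_basis_closedBall.mem_iff.1 (hVo.mem_nhds hyV)
  let b : ContDiffBump y := ⟨r0 / 2, r0, by positivity, by linarith⟩
  set ρ' : EuclideanSpace ℝ (Fin N) → ℝ := fun x => b x * ρ x with hρ'
  have hρ'c : ContDiff ℝ 1 ρ' := by
    rw [contDiff_iff_contDiffAt]
    intro x
    by_cases hx : x ∈ closedBall y r0
    · exact b.contDiffAt.mul (hρ.contDiffAt (hVo.mem_nhds (hr0V hx)))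
    · refine (contDiffAt_const (c := (0:ℝ))).congr_of_eventuallyEq ?_
      filter_upwards [isClosed_closedBall.isOpen_compl.mem_nhds hx] with z hz
      have hz : z ∉ closedBall y r0 := hz
      have : b z = 0 := b.zero_of_le_dist (not_le.1 hz).le
      simp [hρ', this]
  have hρ'e : ∀ x ∈ closedBall y (r0 / 2), ρ' x = ρ x := by
    intro x hx
    have : b x = 1 := b.one_of_mem_closedBall hx
    simp [hρ', this]
  have hfd : fderiv ℝ ρ' y = fderiv ℝ ρ y := by
    apply Filter.EventuallyEq.fderiv_eq
    filter_upwards [closedBall_mem_nhds y (by positivity : 0 < r0 / 2)] with x hx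
    exact hρ'e x hx
  have hne : fderiv ℝ ρ' y ≠ 0 := by
    rw [hfd]
    intro h
    apply hgr
    simp [gradient, h]
  obtain ⟨d, hd⟩ : ∃ d, fderiv ℝ ρ' y d = 1 := by
    obtain ⟨d, hd⟩ : ∃ d, fderiv ℝ ρ' y d ≠ 0 := by
      by_contra! h
      exact hne (ContinuousLinearMap.ext h)
    refine ⟨(fderiv ℝ ρ' y d)⁻¹ • d, ?_⟩
    simp [hd]
  have hc := hρ'c.continuous_fderiv one_ne_zero
  have e1 : ∀ᶠ x in nhds y, 1 / 2 < fderiv ℝ ρ' x d :=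
    ((hc.clm_apply continuous_const).continuousAt (x := y)).eventually
      (lt_mem_nhds (by simp only [hd]; norm_num))
  have e2 : ∀ᶠ x in nhds y, ‖fderiv ℝ ρ' x‖ < ‖fderiv ℝ ρ' y‖ + 1 :=
    (hc.norm.continuousAt (x := y)).eventually (gt_mem_nhds (by linarith))
  have e3 : ∀ᶠ x in nhds y, x ∈ closedBall y (r0 / 2) :=
    closedBall_mem_nhds y (by positivity : 0 < r0 / 2)
  obtain ⟨r, hr, hrs⟩ := Metric.nhds_basis_closedBall.mem_iff.1 (e1.and (e2.and e3))
  have hrs' : ∀ x ∈ closedBall y r, 1 / 2 < fderiv ℝ ρ' x d ∧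
      ‖fderiv ℝ ρ' x‖ < ‖fderiv ℝ ρ' y‖ + 1 ∧ x ∈ closedBall y (r0 / 2) := fun x hx => hrs hx
  let χ : ContDiffBump y := ⟨r / 2, r, by positivity, by linarith⟩
  refine ⟨χ, fun φ hφ => ?_⟩
  refine bdry_core hΩo hTi hT0 hTc hT y d hr hρ'c ?_ (fun x hx => (hrs' x hx).1.le)
    (C := ‖fderiv ℝ ρ' y‖ + 1) (fun x hx => (hrs' x hx).2.1.le) χ rfl φ hφ
  intro x hx
  have hx2 := (hrs' x hx).2.2
  rw [hρ'e x hx2]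
  exact hρΩ x (hr0V (closedBall_subset_closedBall (by linarith) hx2))

set_option maxHeartbeats 800000 in
lemma bdry_global {N : ℕ} {Ω : Set (EuclideanSpace ℝ (Fin N))} (hΩo : IsOpen Ω)
    (hΩb : IsBounded Ω) (hΩbd : HasC1Boundary Ω)
    {T : EuclideanSpace ℝ (Fin N) → EuclideanSpace ℝ (Fin N)}
    (hTi : Integrable T) (hT0 : ∀ x ∉ Ω, T x = 0)
    (hTc : ∀ x ∈ frontier Ω, ContinuousAt T x)
    (hT : ∀ φ : EuclideanSpace ℝ (Fin N) → ℝ, ContDiff ℝ 1 φ → HasCompactSupport φ →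
      tsupport φ ⊆ Ω → ∫ x, fderiv ℝ φ x (T x) = 0)
    (φ : EuclideanSpace ℝ (Fin N) → ℝ) (hφ : ContDiff ℝ 1 φ) :
    ∫ x, fderiv ℝ φ x (T x) = 0 := by
  have hK : IsCompact (closure Ω) := hΩb.isCompact_closure
  have hint : ∀ φ : EuclideanSpace ℝ (Fin N) → ℝ, ContDiff ℝ 1 φ →
      Integrable (fun x => fderiv ℝ φ x (T x)) := by
    intro φ hφ
    have hc := hφ.continuous_fderiv one_ne_zero
    obtain ⟨K, hKb⟩ := hK.exists_bound_of_continuousOn hc.continuousOn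
    refine integrable_clm_apply' hc (K := K) (fun x hx => hKb x (subset_closure ?_)) hTi
    by_contra h
    exact hx (hT0 x h)
  have main : ∃ χ : EuclideanSpace ℝ (Fin N) → ℝ, ContDiff ℝ 1 χ ∧ (∀ x ∈ closure Ω, χ x = 1) ∧
      ∀ φ : EuclideanSpace ℝ (Fin N) → ℝ, ContDiff ℝ 1 φ →
      ∫ x, fderiv ℝ (fun z => χ z * φ z) x (T x) = 0 := by
    refine hK.induction_on (p := fun S => ∃ χ : EuclideanSpace ℝ (Fin N) → ℝ, ContDiff ℝ 1 χ ∧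
      (∀ x ∈ S, χ x = 1) ∧
      ∀ φ : EuclideanSpace ℝ (Fin N) → ℝ, ContDiff ℝ 1 φ →
      ∫ x, fderiv ℝ (fun z => χ z * φ z) x (T x) = 0) ?_ ?_ ?_ ?_
    · exact ⟨fun _ => 0, contDiff_const, by simp, by simp⟩
    · rintro s t hst ⟨χ, h1, h2, h3⟩
      exact ⟨χ, h1, fun x hx => h2 x (hst hx), h3⟩
    · rintro s t ⟨χ, h1, h2, h3⟩ ⟨χ', h1', h2', h3'⟩
      refine ⟨fun x => χ x + χ' x - χ x * χ' x, (h1.add h1').sub (h1.mul h1'), ?_, ?_⟩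
      · rintro x (hx | hx)
        · simp [h2 x hx]
        · simp [h2' x hx]
      · intro φ hφ
        have c1 : ContDiff ℝ 1 (fun z => χ z * φ z) := h1.mul hφ
        have c2 : ContDiff ℝ 1 (fun z => χ' z * φ z) := h1'.mul hφ
        have c3 : ContDiff ℝ 1 (fun z => χ z * (χ' z * φ z)) := h1.mul c2
        have : ∀ x, fderiv ℝ (fun z => (χ z + χ' z - χ z * χ' z) * φ z) x (T x) =
            fderiv ℝ (fun z => χ z * φ z) x (T x) + fderiv ℝ (fun z => χ' z * φ z) x (T x)
            - fderiv ℝ (fun z => χ z * (χ' z * φ z)) x (T x) := by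
          intro x
          have e : (fun z => (χ z + χ' z - χ z * χ' z) * φ z) =
            (fun z => (χ z * φ z + χ' z * φ z) - χ z * (χ' z * φ z)) := by
            ext z; ring
          have d1 := c1.differentiable one_ne_zero x
          have d2 := c2.differentiable one_ne_zero x
          have d3 := c3.differentiable one_ne_zero x
          rw [e, ((d1.hasFDerivAt.fun_add d2.hasFDerivAt).fun_sub d3.hasFDerivAt).fderiv]
          simp
        simp_rw [this]
        rw [integral_sub ((hint _ c1).fun_add (hint _ c2)) (hint _ c3),
          integral_add (hint _ c1) (hint _ c2), h3 _ hφ, h3' _ hφ, h3 _ c2]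
        simp
    · intro y hy
      by_cases hyΩ : y ∈ Ω
      · obtain ⟨r, hr, hrΩ⟩ := Metric.nhds_basis_closedBall.mem_iff.1 (hΩo.mem_nhds hyΩ)
        let χ : ContDiffBump y := ⟨r / 2, r, by positivity, by linarith⟩
        refine ⟨closedBall y (r / 2), mem_nhdsWithin_of_mem_nhds
          (closedBall_mem_nhds y (by positivity)), fun x => χ x, χ.contDiff,
          fun x hx => χ.one_of_mem_closedBall hx, fun φ hφ => ?_⟩
        refine hT _ (χ.contDiff.mul hφ) χ.hasCompactSupport.mul_right ?_
        refine (tsupport_mul_subset_left (f := fun z => χ z)).trans ?_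
        exact χ.tsupport_eq.subset.trans hrΩ
      · have hyf : y ∈ frontier Ω := by rw [hΩo.frontier_eq]; exact ⟨hy, hyΩ⟩
        obtain ⟨χ, hχ⟩ := bdry_local hΩo hΩbd hTi hT0 hTc hT y hyf
        exact ⟨closedBall y χ.rIn, mem_nhdsWithin_of_mem_nhds
          (closedBall_mem_nhds y χ.rIn_pos), fun x => χ x, χ.contDiff,
          fun x hx => χ.one_of_mem_closedBall hx, hχ⟩
  obtain ⟨χ, h1, h2, h3⟩ := main
  rw [← h3 φ hφ]
  refine integral_congr_ae ?_
  filter_upwards with x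
  by_cases hx : x ∈ Ω
  · have : (fun z => χ z * φ z) =ᶠ[nhds x] φ := by
      filter_upwards [hΩo.mem_nhds hx] with z hz
      rw [h2 z (subset_closure hz), one_mul]
    rw [this.fderiv_eq]
  · simp [hT0 x hx]


set_option maxHeartbeats 800000 in
lemma test_upgrade {N : ℕ} {Ω : Set (EuclideanSpace ℝ (Fin N))} (hΩo : IsOpen Ω)
    {T : EuclideanSpace ℝ (Fin N) → EuclideanSpace ℝ (Fin N)} (hTi : Integrable T)
    (hT : ∀ φ : EuclideanSpace ℝ (Fin N) → ℝ, IsTestFun Ω φ → ∫ x, fderiv ℝ φ x (T x) = 0)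
    (φ : EuclideanSpace ℝ (Fin N) → ℝ) (hφ : ContDiff ℝ 1 φ) (hφs : HasCompactSupport φ)
    (hφΩ : tsupport φ ⊆ Ω) : ∫ x, fderiv ℝ φ x (T x) = 0 := by
  have hc := hφ.continuous_fderiv one_ne_zero
  have hfs := hφs.fderiv ℝ
  have huc : UniformContinuous (fderiv ℝ φ) := hfs.uniformContinuous_of_continuous hc
  have hcsb : ∀ (A : EuclideanSpace ℝ (Fin N) → EuclideanSpace ℝ (Fin N) →L[ℝ] ℝ),
      Continuous A → HasCompactSupport A → Integrable (fun x => A x (T x)) := by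
    intro A hA hAs
    obtain ⟨K, hK⟩ := hA.bounded_above_of_compact_support hAs
    exact integrable_clm_apply' hA (fun x _ => hK x) hTi
  obtain ⟨δ, hδ, hδΩ⟩ := hφs.isCompact.exists_cthickening_subset_open hΩo hφΩ
  have key : ∀ η > 0, ‖∫ x, fderiv ℝ φ x (T x)‖ ≤ η * ∫ x, ‖T x‖ := by
    intro η hη
    obtain ⟨δ', hδ', hη'⟩ := Metric.uniformContinuous_iff.1 huc η hη
    have hm : 0 < min δ δ' := lt_min hδ hδ'
    let b : ContDiffBump (0 : EuclideanSpace ℝ (Fin N)) :=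
      ⟨min δ δ' / 2, min δ δ', by positivity, by linarith⟩
    have hbr : b.rOut = min δ δ' := rfl
    set ψ := convolution (b.normed volume) φ (ContinuousLinearMap.lsmul ℝ ℝ) volume with hψ
    have hψc : ContDiff ℝ (⊤ : ℕ∞) ψ :=
      b.hasCompactSupport_normed.contDiff_convolution_left _ b.contDiff_normed
        hφ.continuous.locallyIntegrable
    have hψs : tsupport ψ ⊆ cthickening δ (tsupport φ) := by
      refine closure_minimal ?_ isClosed_cthickening
      intro x hx
      by_contra hxn
      apply hx
      have hz : ∀ z ∈ ball x b.rOut, φ z = 0 := by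
        intro z hz
        by_contra hne
        apply hxn
        refine mem_cthickening_of_dist_le x z δ _ (subset_tsupport _ hne) ?_
        rw [dist_comm]
        exact (mem_ball.1 hz).le.trans (min_le_left _ _)
      have hx0 : φ x = 0 := hz x (mem_ball_self b.rOut_pos)
      rw [hψ, b.normed_convolution_eq_right (fun z h => by rw [hz z h, hx0]), hx0]
    have hψcs : HasCompactSupport ψ :=
      hφs.isCompact.cthickening.of_isClosed_subset (isClosed_tsupport _) hψs
    have h0 := hT ψ ⟨hψc, hψcs, hψs.trans hδΩ⟩
    have hclose : ∀ x, ‖fderiv ℝ φ x - fderiv ℝ ψ x‖ ≤ η := by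
      intro x
      have hd := HasCompactSupport.hasFDerivAt_convolution_right (μ := volume)
        (ContinuousLinearMap.lsmul ℝ ℝ) hφs
        (b.continuous_normed (μ := volume)).locallyIntegrable hφ x
      have hL : (ContinuousLinearMap.lsmul ℝ ℝ : ℝ →L[ℝ] ℝ →L[ℝ] ℝ).precompR
          (EuclideanSpace ℝ (Fin N)) = ContinuousLinearMap.lsmul ℝ ℝ := by
        ext
        simp
      rw [hL] at hd
      rw [hd.fderiv, ← dist_eq_norm, dist_comm]
      refine b.dist_normed_convolution_le hc.aestronglyMeasurable fun z hz => ?_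
      exact (hη' ((mem_ball.1 hz).trans_le (min_le_right _ _))).le
    have hψ1 : ContDiff ℝ 1 ψ := hψc.of_le (by exact_mod_cast le_top)
    have i2 := hcsb _ (hψ1.continuous_fderiv one_ne_zero) (hψcs.fderiv ℝ)
    have i1 := hcsb _ hc hfs
    have e : ∫ x, fderiv ℝ φ x (T x) = ∫ x, (fderiv ℝ φ x (T x) - fderiv ℝ ψ x (T x)) := by
      rw [integral_sub i1 i2, h0, sub_zero]
    rw [e, ← integral_const_mul]
    refine norm_integral_le_of_norm_le (hTi.norm.const_mul _) ?_
    filter_upwards with x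
    have := (fderiv ℝ φ x - fderiv ℝ ψ x).le_opNorm (T x)
    rw [sub_apply] at this
    exact this.trans (mul_le_mul_of_nonneg_right (hclose x) (norm_nonneg _))
  have ht : Filter.Tendsto (fun η : ℝ => η * ∫ x, ‖T x‖) (nhdsWithin 0 (Ioi 0)) (nhds 0) := by
    have : Filter.Tendsto (fun η : ℝ => η * ∫ x, ‖T x‖) (nhds 0) (nhds (0 * ∫ x, ‖T x‖)) :=
      (continuous_id.mul continuous_const).tendsto 0
    rw [zero_mul] at this
    exact this.mono_left nhdsWithin_le_nhds
  have := ge_of_tendsto ht (by filter_upwards [self_mem_nhdsWithin] with δ hδ using key δ hδ)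
  exact norm_le_zero_iff.1 this


lemma gvec_norm {N : ℕ} {g : ℝ → ℝ} (hgm : StrictMonoOn g (Ici 0)) (hg0 : g 0 = 0)
    (p : EuclideanSpace ℝ (Fin N)) : ‖gvec g p‖ = g ‖p‖ := by
  unfold gvec
  split_ifs with h
  · simp [h, hg0]
  · have hp : 0 < ‖p‖ := norm_pos_iff.2 h
    have hg : 0 < g ‖p‖ := hg0 ▸ hgm (self_mem_Ici) hp.le hp
    rw [norm_smul, Real.norm_of_nonneg (by positivity)]
    field_simp

lemma gvec_continuous {N : ℕ} {g : ℝ → ℝ} (hgc : ContinuousOn g (Ici 0))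
    (hgm : StrictMonoOn g (Ici 0)) (hg0 : g 0 = 0) :
    Continuous (gvec g : EuclideanSpace ℝ (Fin N) → EuclideanSpace ℝ (Fin N)) := by
  have hgn : Continuous fun p : EuclideanSpace ℝ (Fin N) => g ‖p‖ :=
    hgc.comp_continuous continuous_norm fun p => norm_nonneg p
  rw [continuous_iff_continuousAt]
  intro p
  by_cases hp : p = 0
  · subst hp
    have h0 : gvec g (0 : EuclideanSpace ℝ (Fin N)) = 0 := by simp [gvec]
    unfold ContinuousAt
    rw [h0, tendsto_zero_iff_norm_tendsto_zero]
    simp only [gvec_norm hgm hg0]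
    have := hgn.tendsto 0
    simpa [hg0] using this
  · have : gvec g =ᶠ[nhds p] fun y => (g ‖y‖ / ‖y‖) • y := by
      filter_upwards [isOpen_ne.mem_nhds hp] with y hy
      have hy : y ≠ 0 := hy
      simp [gvec, hy]
    refine ContinuousAt.congr ?_ this.symm
    exact (hgn.continuousAt.div continuous_norm.continuousAt (norm_ne_zero_iff.2 hp)).smul
      continuousAt_id

lemma gvec_inner_nonneg_aux {N : ℕ} {g : ℝ → ℝ} (hgm : StrictMonoOn g (Ici 0)) (hg0 : g 0 = 0)
    (p e : EuclideanSpace ℝ (Fin N)) : 0 ≤ ⟪p, e⟫ * ⟪gvec g p, e⟫ := by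
  unfold gvec
  split_ifs with h
  · simp
  · have hp : 0 < ‖p‖ := norm_pos_iff.2 h
    have hg : 0 < g ‖p‖ := hg0 ▸ hgm (self_mem_Ici) hp.le hp
    rw [real_inner_smul_left]
    have : 0 ≤ g ‖p‖ / ‖p‖ * (⟪p, e⟫ * ⟪p, e⟫) :=
      mul_nonneg (by positivity) (mul_self_nonneg _)
    linarith

lemma gvec_inner_zero_aux {N : ℕ} {g : ℝ → ℝ} (hgm : StrictMonoOn g (Ici 0)) (hg0 : g 0 = 0)
    (p e : EuclideanSpace ℝ (Fin N)) (h0 : ⟪p, e⟫ * ⟪gvec g p, e⟫ = 0) : ⟪p, e⟫ = 0 := by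
  unfold gvec at h0
  split_ifs at h0 with h
  · simp [h]
  · have hp : 0 < ‖p‖ := norm_pos_iff.2 h
    have hg : 0 < g ‖p‖ := hg0 ▸ hgm (self_mem_Ici) hp.le hp
    rw [real_inner_smul_left] at h0
    have hq : g ‖p‖ / ‖p‖ ≠ 0 := by positivity
    simpa [hq] using h0

lemma gvec_inner_self {N : ℕ} {g : ℝ → ℝ} (p : EuclideanSpace ℝ (Fin N)) :
    ⟪gvec g p, p⟫ = g ‖p‖ * ‖p‖ := by
  unfold gvec
  split_ifs with h
  · simp [h]
  · have hp : 0 < ‖p‖ := norm_pos_iff.2 h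
    rw [real_inner_smul_left, real_inner_self_eq_norm_sq]
    field_simp

lemma Ghat_hasFDerivAt {N : ℕ} {g : ℝ → ℝ} (hgc : ContinuousOn g (Ici 0)) (hg0 : g 0 = 0)
    (p : EuclideanSpace ℝ (Fin N)) :
    HasFDerivAt (fun y : EuclideanSpace ℝ (Fin N) => Gfun g ‖y‖) (innerSL ℝ (gvec g p)) p := by
  set g' : ℝ → ℝ := fun t => g (max t 0) with hg'
  have hg'c : Continuous g' :=
    hgc.comp_continuous (continuous_id.max continuous_const) fun t => mem_Ici.2 (le_max_right _ _)
  have heq : ∀ y : EuclideanSpace ℝ (Fin N), Gfun g ‖y‖ = Gfun g' ‖y‖ := by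
    intro y
    unfold Gfun
    refine intervalIntegral.integral_congr fun s hs => ?_
    rw [uIcc_of_le (norm_nonneg y)] at hs
    simp only [hg', max_eq_left hs.1]
  have hd : ∀ t, HasDerivAt (Gfun g') (g' t) t := fun t =>
    intervalIntegral.integral_hasDerivAt_right (hg'c.intervalIntegrable _ _)
      (hg'c.stronglyMeasurableAtFilter _ _) hg'c.continuousAt
  simp only [heq]
  by_cases hp : p = 0
  · subst hp
    have h0 : gvec g (0 : EuclideanSpace ℝ (Fin N)) = 0 := by simp [gvec]
    rw [h0, map_zero]
    have h1 := (hd 0)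
    have hg'0 : g' 0 = 0 := by simp [hg', hg0]
    rw [hg'0, hasDerivAt_iff_isLittleO_nhds_zero] at h1
    rw [hasFDerivAt_iff_isLittleO_nhds_zero]
    have ht : Filter.Tendsto (fun h : EuclideanSpace ℝ (Fin N) => ‖h‖) (nhds 0) (nhds 0) := by
      simpa using (continuous_norm (E := EuclideanSpace ℝ (Fin N))).tendsto 0
    have h2 := h1.comp_tendsto ht
    have h3 := h2.of_norm_right
    simpa [Function.comp_def] using h3
  · have hpn : ‖p‖ ≠ 0 := norm_ne_zero_iff.2 hp
    have hn : HasFDerivAt (fun y : EuclideanSpace ℝ (Fin N) => ‖y‖)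
        ((1 / ‖p‖) • innerSL ℝ p) p := by
      have h1 := ((hasFDerivAt_id p).norm_sq).sqrt (by simpa using hpn)
      simp only [id, Real.sqrt_sq (norm_nonneg _)] at h1
      refine h1.congr_fderiv ?_
      ext y
      simp only [smul_apply, ContinuousLinearMap.comp_id, smul_eq_mul, nsmul_eq_mul]
      push_cast
      field_simp
    have := (hd ‖p‖).comp_hasFDerivAt p hn
    refine this.congr_fderiv ?_
    ext y
    simp only [gvec, hp, if_false, smul_apply, innerSL_apply_apply, real_inner_smul_left, hg',
      max_eq_left (norm_nonneg p), smul_eq_mul]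
    ring

lemma fderiv_gradient {N : ℕ} (φ : EuclideanSpace ℝ (Fin N) → ℝ) (x v : EuclideanSpace ℝ (Fin N)) :
    fderiv ℝ φ x v = ⟪gradient φ x, v⟫ := by
  unfold gradient
  rw [InnerProductSpace.toDual_symm_apply]

lemma norm_gradient {N : ℕ} (φ : EuclideanSpace ℝ (Fin N) → ℝ) (x : EuclideanSpace ℝ (Fin N)) :
    ‖gradient φ x‖ = ‖fderiv ℝ φ x‖ := by
  unfold gradient
  rw [LinearIsometryEquiv.norm_map]

lemma gradient_continuous {N : ℕ} {φ : EuclideanSpace ℝ (Fin N) → ℝ} (hφ : ContDiff ℝ 1 φ) :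
    Continuous (gradient φ) := by
  unfold gradient
  exact (LinearIsometryEquiv.continuous _).comp (hφ.continuous_fderiv one_ne_zero)

lemma ext_hasFDerivAt_zero {N : ℕ} {Ω : Set (EuclideanSpace ℝ (Fin N))}
    (hΩo : IsOpen Ω)
    {u : EuclideanSpace ℝ (Fin N) → ℝ} (hX : MemX Ω u) (hneu : NeumannZero Ω u) :
    ∀ x ∉ Ω, HasFDerivAt (Ω.indicator u) (0 : EuclideanSpace ℝ (Fin N) →L[ℝ] ℝ) x := by
  have hwu : ∀ x ∈ closure Ω, Ω.indicator u x = u x := by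
    intro x hx
    by_cases h : x ∈ Ω
    · simp [h]
    · have : x ∈ frontier Ω := by rw [hΩo.frontier_eq]; exact ⟨hx, h⟩
      simp [h, hX.2 x this]
  intro y hyn
  by_cases hyc : y ∈ closure Ω
  · have hy : y ∈ frontier Ω := by rw [hΩo.frontier_eq]; exact ⟨hyc, hyn⟩
    have h1 : HasFDerivWithinAt (Ω.indicator u) (0 : _ →L[ℝ] ℝ) (closure Ω) y :=
      (hneu y hy).congr hwu (hwu y hyc)
    have h2 : HasFDerivWithinAt (Ω.indicator u) (0 : _ →L[ℝ] ℝ) (closure Ω)ᶜ y := by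
      refine (hasFDerivWithinAt_const (0:ℝ) y _).congr ?_ ?_
      · intro x hx
        exact indicator_of_notMem (fun h => hx (subset_closure h)) _
      · rw [hwu y hyc, hX.2 y hy]
    have := h1.union h2
    rwa [union_compl_self, hasFDerivWithinAt_univ] at this
  · have : Ω.indicator u =ᶠ[nhds y] fun _ => 0 := by
      filter_upwards [isClosed_closure.isOpen_compl.mem_nhds hyc] with z hz
      exact indicator_of_notMem (fun h => hz (subset_closure h)) _
    exact (hasFDerivAt_const (0:ℝ) y).congr_of_eventuallyEq this

/-- A `C¹` function of compact support with vanishing derivative in a direction is zero. -/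
lemma zero_of_dir {N : ℕ} {Ω : Set (EuclideanSpace ℝ (Fin N))} (hΩb : IsBounded Ω)
    {w : EuclideanSpace ℝ (Fin N) → ℝ} (hw : ContDiff ℝ 1 w) (hw0 : ∀ x ∉ Ω, w x = 0)
    (e : EuclideanSpace ℝ (Fin N)) (he : ‖e‖ = 1) (h : ∀ x, fderiv ℝ w x e = 0) (x) : w x = 0 := by
  obtain ⟨R, hR0, hR⟩ := hΩb.subset_ball_lt 0 0
  have hd : ∀ s : ℝ, HasDerivAt (fun s : ℝ => w (x + s • e)) 0 s := by
    intro s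
    have h1 : HasDerivAt (fun s : ℝ => x + s • e) e s := by
      simpa using ((hasDerivAt_id s).smul_const e).const_add x
    have := ((hw.differentiable one_ne_zero) (x + s • e)).hasFDerivAt.comp_hasDerivAt s h1
    rwa [h] at this
  have hc := is_const_of_deriv_eq_zero (fun s => (hd s).differentiableAt) (fun s => (hd s).deriv)
    0 (R + ‖x‖)
  simp only [zero_smul, add_zero] at hc
  rw [hc]
  refine hw0 _ fun hmem => ?_
  have h2 := hR hmem
  rw [mem_ball_zero_iff] at h2
  have h3 : ‖(R + ‖x‖) • e‖ ≤ ‖x + (R + ‖x‖) • e‖ + ‖x‖ := by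
    have := norm_sub_le (x + (R + ‖x‖) • e) x
    rwa [add_sub_cancel_left] at this
  rw [norm_smul, he, Real.norm_of_nonneg (by positivity)] at h3
  linarith

lemma case_one {N : ℕ} {Ω : Set (EuclideanSpace ℝ (Fin N))} (hN : 1 ≤ N) (hΩo : IsOpen Ω)
    (hΩb : IsBounded Ω) (hΩbd : HasC1Boundary Ω) {g : ℝ → ℝ} (hgc : ContinuousOn g (Ici 0))
    (hgm : StrictMonoOn g (Ici 0)) (hg0 : g 0 = 0)
    {w : EuclideanSpace ℝ (Fin N) → ℝ} (hw : ContDiff ℝ 1 w) (hw0 : ∀ x ∉ Ω, w x = 0)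
    (hwg : ∀ x ∉ Ω, gradient w x = 0)
    (h : ∀ φ, IsTestFun Ω φ → ∫ x in Ω, ⟪gvec g (gradient w x), gradient φ x⟫ = 0) (x) :
    w x = 0 := by
  set T := fun x => gvec g (gradient w x) with hTdef
  have hTc : Continuous T := (gvec_continuous hgc hgm hg0).comp (gradient_continuous hw)
  have hT0 : ∀ x ∉ Ω, T x = 0 := fun x hx => by simp [hTdef, hwg x hx, gvec]
  have hTs : HasCompactSupport T :=
    HasCompactSupport.intro hΩb.isCompact_closure fun x hx => hT0 x fun h => hx (subset_closure h)
  have hTi : Integrable T := hTc.integrable_of_hasCompactSupport hTs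
  have h1 : ∀ φ, IsTestFun Ω φ → ∫ x, fderiv ℝ φ x (T x) = 0 := by
    intro φ hφ
    rw [← h φ hφ, ← setIntegral_eq_integral_of_forall_compl_eq_zero (s := Ω)]
    · refine integral_congr_ae (Filter.Eventually.of_forall fun x => ?_)
      simp only
      rw [fderiv_gradient, real_inner_comm]
    · intro x hx
      rw [hT0 x hx, map_zero]
  have h2 := bdry_global hΩo hΩb hΩbd hTi hT0 (fun x _ => hTc.continuousAt)
    (test_upgrade hΩo hTi h1) w hw
  have h3 : ∀ x, fderiv ℝ w x (T x) = g ‖gradient w x‖ * ‖gradient w x‖ := by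
    intro x
    rw [fderiv_gradient, real_inner_comm, hTdef, gvec_inner_self]
  have hnn : ∀ y : EuclideanSpace ℝ (Fin N), 0 ≤ g ‖y‖ := fun y => by
    rw [← gvec_norm hgm hg0]; exact norm_nonneg _
  have hcont : Continuous fun x => fderiv ℝ w x (T x) :=
    (hw.continuous_fderiv one_ne_zero).clm_apply hTc
  have hsupp : HasCompactSupport fun x => fderiv ℝ w x (T x) :=
    HasCompactSupport.intro hΩb.isCompact_closure fun x hx => by
      rw [hT0 x fun h => hx (subset_closure h), map_zero]
  have h4 : (fun x => fderiv ℝ w x (T x)) = 0 := by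
    refine (hcont.ae_eq_iff_eq volume continuous_const).1 ((integral_eq_zero_iff_of_nonneg ?_
      (hcont.integrable_of_hasCompactSupport hsupp)).1 h2)
    intro x
    simp only [Pi.zero_apply, h3]
    exact mul_nonneg (hnn _) (norm_nonneg _)
  have h5 : ∀ x, gradient w x = 0 := by
    intro x
    have h6 : fderiv ℝ w x (T x) = 0 := congrFun h4 x
    rw [h3] at h6
    by_contra hne
    have hp : 0 < ‖gradient w x‖ := norm_pos_iff.2 hne
    have hg : 0 < g ‖gradient w x‖ := hg0 ▸ hgm (self_mem_Ici) hp.le hp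
    exact absurd h6 (by positivity)
  refine zero_of_dir hΩb hw hw0 (EuclideanSpace.single ⟨0, hN⟩ 1) (by simp) (fun x => ?_) x
  rw [fderiv_gradient, h5, inner_zero_left]

open scoped ENNReal NNReal in
/-- One-dimensional area inequality without measurability. -/
lemma oned_ineq (h : ℝ → ℝ≥0∞) {γ : ℝ → ℝ} {C : ℝ≥0} (hγ : LipschitzWith C γ) {D b : ℝ}
    (hD : 0 ≤ D) (hb : b ≤ γ D) :
    ∫⁻ y in Ioc (γ 0) b, h y ≤ C * ∫⁻ s in {s | s ∈ Icc 0 D ∧ γ s ≤ b}, h (γ s) := by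
  set S : Set ℝ := {s | s ∈ Icc 0 D ∧ γ s ≤ b} with hS
  have hSm : MeasurableSet S :=
    measurableSet_Icc.inter (hγ.continuous.measurable measurableSet_Iic)
  have hle : volume.restrict (Ioc (γ 0) b) ≤
      Measure.map γ ((C : ℝ≥0∞) • volume.restrict S) := by
    rw [Measure.le_iff]
    intro A hA
    rw [Measure.map_apply hγ.continuous.measurable hA, Measure.restrict_apply hA,
      Measure.smul_apply, Measure.restrict_apply (hγ.continuous.measurable hA), smul_eq_mul]
    have hsub : A ∩ Ioc (γ 0) b ⊆ γ '' (γ ⁻¹' A ∩ S) := by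
      rintro y ⟨hyA, hy⟩
      obtain ⟨s, hs, rfl⟩ := intermediate_value_Icc hD hγ.continuous.continuousOn
        (show y ∈ Icc (γ 0) (γ D) from ⟨hy.1.le, hy.2.trans hb⟩)
      exact ⟨s, ⟨hyA, hs, hy.2⟩, rfl⟩
    refine (measure_mono hsub).trans ?_
    have := hγ.hausdorffMeasure_image_le (d := 1) zero_le_one (γ ⁻¹' A ∩ S)
    rwa [hausdorffMeasure_real, ENNReal.rpow_one] at this
  calc ∫⁻ y in Ioc (γ 0) b, h y ≤ ∫⁻ y, h y ∂(Measure.map γ ((C : ℝ≥0∞) • volume.restrict S)) :=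
        lintegral_mono' hle le_rfl
    _ ≤ ∫⁻ s, h (γ s) ∂((C : ℝ≥0∞) • volume.restrict S) := lintegral_map_le _ _
    _ = _ := by rw [lintegral_smul_measure, smul_eq_mul]

lemma cutoff_exists {N : ℕ} {Ω K : Set (EuclideanSpace ℝ (Fin N))} (hΩo : IsOpen Ω)
    (hK : IsCompact K) (hKΩ : K ⊆ Ω) :
    ∃ φ : EuclideanSpace ℝ (Fin N) → ℝ, IsTestFun Ω φ ∧ ∀ x ∈ K, φ x = 1 := by
  obtain ⟨δ, hδ, hδΩ⟩ := hK.exists_cthickening_subset_open hΩo hKΩ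
  obtain ⟨φ, h1, h0, -⟩ := exists_contMDiffMap_one_nhds_of_subset_interior
    (modelWithCornersSelf ℝ (EuclideanSpace ℝ (Fin N))) (n := ⊤) (t := cthickening δ K) hK.isClosed
    ((self_subset_thickening hδ K).trans
      (interior_maximal (thickening_subset_cthickening δ K) isOpen_thickening))
  have hts : tsupport φ ⊆ cthickening δ K := by
    refine closure_minimal ?_ isClosed_cthickening
    intro x hx
    by_contra hn
    exact hx (h0 x hn)
  refine ⟨φ, ⟨φ.contMDiff.contDiff, ?_, hts.trans hδΩ⟩, fun x hx => ?_⟩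
  · exact hK.cthickening.of_isClosed_subset (isClosed_tsupport _) hts
  · exact (Filter.Eventually.self_of_nhdsSet h1) x hx

lemma Gfun_enorm_le (f : ℝ → ℝ) (t : ℝ) : ‖Gfun f t‖ₑ ≤ ∫⁻ s in uIoc 0 t, ‖f s‖ₑ := by
  unfold Gfun
  rw [← ofReal_norm, intervalIntegral.norm_integral_eq_norm_integral_uIoc, ofReal_norm]
  exact enorm_integral_le_lintegral_enorm _

lemma Gfun_intervalIntegrable {f : ℝ → ℝ} (hfc : ContinuousOn f (Ici 0)) {t : ℝ} (ht : 0 ≤ t) :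
    IntervalIntegrable f volume 0 t := by
  apply ContinuousOn.intervalIntegrable
  rw [uIcc_of_le ht]
  exact hfc.mono Icc_subset_Ici_self

lemma Gfun_measurable {f : ℝ → ℝ} (hfc : ContinuousOn f (Ici 0)) : Measurable (Gfun f) := by
  set I : Set ℝ := {t | IntervalIntegrable f volume 0 t} with hI
  have hmem : ∀ t, t ∈ I ↔ IntervalIntegrable f volume 0 t := fun t => Iff.rfl
  have hpos : ∀ t, 0 ≤ t → t ∈ I := fun t ht => Gfun_intervalIntegrable hfc ht
  have hord : OrdConnected I := by
    refine ⟨fun a ha b hb c hc => ?_⟩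
    rcases le_total 0 c with h | h
    · exact hpos c h
    · rw [hmem] at ha ⊢
      refine ha.mono_set ?_
      rw [uIcc_of_ge h, uIcc_of_ge (hc.1.trans h)]
      exact Icc_subset_Icc_left hc.1
  have hcont : ContinuousOn (Gfun f) I := by
    intro t ht
    have key : ∃ s ∈ I, s ≤ 0 ∧ ∀ᶠ x in nhdsWithin t I, x ∈ Icc s (|t| + 1) := by
      have hub : ∀ᶠ x in nhdsWithin t I, x ≤ |t| + 1 :=
        nhdsWithin_le_nhds (Iic_mem_nhds (by linarith [le_abs_self t]))
      by_cases h : ∃ s ∈ I, s < t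
      · obtain ⟨s, hs, hst⟩ := h
        refine ⟨min s 0, ?_, min_le_right _ _, ?_⟩
        · rcases min_choice s 0 with h | h <;> rw [h]
          exacts [hs, hpos 0 le_rfl]
        · have : ∀ᶠ x in nhdsWithin t I, s ≤ x :=
            nhdsWithin_le_nhds (Ici_mem_nhds hst)
          filter_upwards [hub, this] with x h1 h2
          exact ⟨(min_le_left _ _).trans h2, h1⟩
      · push Not at h
        refine ⟨t, ht, h 0 (hpos 0 le_rfl), ?_⟩
        filter_upwards [hub, self_mem_nhdsWithin] with x h1 h2
        exact ⟨h x h2, h1⟩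
    obtain ⟨s, hs, hs0, hev⟩ := key
    have h1 : IntervalIntegrable f volume s (|t| + 1) :=
      ((hmem s).1 hs).symm.trans (hpos _ (by positivity))
    have hc := intervalIntegral.continuousOn_primitive_interval' (a := 0) h1
      (by rw [uIcc_of_le (hs0.trans (by positivity))]; exact ⟨hs0, by positivity⟩)
    rw [uIcc_of_le (hs0.trans (by positivity))] at hc
    have htm : t ∈ Icc s (|t| + 1) := hev.self_of_nhdsWithin ht
    have := hc t htm
    refine this.mono_of_mem_nhdsWithin ?_
    exact hev
  have hpw : Gfun f = I.piecewise (Gfun f) (fun _ => 0) := by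
    ext t
    by_cases ht : t ∈ I
    · simp [ht]
    · simp only [ht, not_false_eq_true, piecewise_eq_of_notMem]
      exact intervalIntegral.integral_undef ht
  rw [hpw]
  exact hcont.measurable_piecewise continuousOn_const hord.measurableSet

lemma Gfun_continuousAt_zero {f : ℝ → ℝ} (hfc : ContinuousOn f (Ici 0)) :
    ContinuousAt (Gfun f) 0 := by
  by_cases h : ∃ δ > 0, IntervalIntegrable f volume 0 (-δ)
  · obtain ⟨δ, hδ, hi⟩ := h
    have h1 : IntervalIntegrable f volume (-δ) 1 :=
      hi.symm.trans (Gfun_intervalIntegrable hfc zero_le_one)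
    have hc := intervalIntegral.continuousOn_primitive_interval' (a := 0) h1
      (by rw [uIcc_of_le (by linarith)]; exact ⟨by linarith, by linarith⟩)
    rw [uIcc_of_le (by linarith)] at hc
    exact hc.continuousAt (Icc_mem_nhds (by linarith) one_pos)
  · push Not at h
    rw [continuousAt_iff_continuous_left_right]
    have h0 : Gfun f 0 = 0 := by simp [Gfun]
    constructor
    · refine (continuousWithinAt_const (b := (0:ℝ))).congr ?_ h0
      intro t ht
      rcases (mem_Iic.1 ht).eq_or_lt with rfl | hlt
      · exact h0
      · refine intervalIntegral.integral_undef ?_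
        have := h (-t) (by linarith)
        rwa [neg_neg] at this
    · have hc := intervalIntegral.continuousOn_primitive_interval' (a := 0)
        (Gfun_intervalIntegrable hfc zero_le_one) (by simp)
      rw [uIcc_of_le zero_le_one] at hc
      exact (hc 0 (by simp)).mono_of_mem_nhdsWithin (Icc_mem_nhdsGE one_pos)

open scoped ENNReal NNReal in
lemma F_integrable {N : ℕ} (hN : 1 ≤ N) {Ω : Set (EuclideanSpace ℝ (Fin N))}
    (hΩo : IsOpen Ω) (hΩb : IsBounded Ω) {f : ℝ → ℝ} (hfc : ContinuousOn f (Ici 0))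
    {w : EuclideanSpace ℝ (Fin N) → ℝ} (hw : ContDiff ℝ 1 w) (hw0 : ∀ x ∉ Ω, w x = 0)
    (hint : ∀ φ, IsTestFun Ω φ → IntegrableOn (fun x => f (w x) * φ x) Ω) :
    Integrable (fun x => Gfun f (w x)) := by
  have hF0 : Gfun f 0 = 0 := by simp [Gfun]
  have hmeas : Measurable fun x => Gfun f (w x) :=
    (Gfun_measurable hfc).comp hw.continuous.measurable
  have hws : HasCompactSupport w :=
    HasCompactSupport.intro hΩb.isCompact_closure fun x hx => hw0 x fun h => hx (subset_closure h)
  obtain ⟨M, hM⟩ := hw.continuous.bounded_above_of_compact_support hws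
  have hM0 : 0 ≤ M := (norm_nonneg _).trans (hM 0)
  set B := ∫⁻ s in uIoc 0 M, ‖f s‖ₑ with hB
  have hBt : B < ∞ := (Gfun_intervalIntegrable hfc hM0).def'.2
  have hBle : ∀ x, 0 ≤ w x → ‖Gfun f (w x)‖ₑ ≤ B := by
    intro x hx
    refine (Gfun_enorm_le f _).trans (lintegral_mono_set ?_)
    rw [uIoc_of_le hx, uIoc_of_le hM0]
    exact Ioc_subset_Ioc_right ((le_abs_self _).trans (hM x))
  have hΩfin : volume Ω < ∞ := hΩb.measure_lt_top
  rw [← integrableOn_iff_integrable_of_support_subset (s := Ω)]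
  swap
  · intro x hx
    by_contra hn
    exact hx (by simp only [hw0 x hn, hF0])
  refine ⟨hmeas.aestronglyMeasurable, ?_⟩
  by_cases h : ∃ δ > 0, IntervalIntegrable f volume 0 (-δ)
  swap
  · push Not at h
    have hle : ∀ x, ‖Gfun f (w x)‖ₑ ≤ B := by
      intro x
      rcases le_or_gt 0 (w x) with hx | hx
      · exact hBle x hx
      · have h1 := h (-(w x)) (by linarith)
        rw [neg_neg] at h1
        have : Gfun f (w x) = 0 := intervalIntegral.integral_undef h1
        simp [this]
    refine (lintegral_mono hle).trans_lt ?_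
    rw [lintegral_const, Measure.restrict_apply_univ]
    exact ENNReal.mul_lt_top hBt hΩfin
  obtain ⟨δ, hδ, hi⟩ := h
  set A := ∫⁻ s in uIoc 0 (-δ), ‖f s‖ₑ with hA
  have hAt : A < ∞ := hi.def'.2
  set e : EuclideanSpace ℝ (Fin N) := EuclideanSpace.single ⟨0, hN⟩ 1 with he
  have hen : ‖e‖ = 1 := by simp [he]
  obtain ⟨R, hR0, hR⟩ := hΩb.subset_ball_lt 0 0
  set D : ℝ := 2 * R with hD
  obtain ⟨C, hC⟩ := hw.lipschitzWith_of_hasCompactSupport hws one_ne_zero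
  set K : Set (EuclideanSpace ℝ (Fin N)) := {x | w x ≤ -δ} with hKd
  have hKmem : ∀ x, x ∈ K ↔ w x ≤ -δ := fun x => Iff.rfl
  have hKΩ : K ⊆ Ω := by
    intro x hx
    by_contra hn
    rw [hKmem, hw0 x hn] at hx
    linarith
  have hKcl : IsClosed K := isClosed_le hw.continuous continuous_const
  have hKc : IsCompact K :=
    hΩb.isCompact_closure.of_isClosed_subset hKcl (hKΩ.trans subset_closure)
  obtain ⟨φ, hφ, hφ1⟩ := cutoff_exists hΩo hKc hKΩ
  have hfK : IntegrableOn (fun x => f (w x)) K := by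
    refine ((hint φ hφ).mono_set hKΩ).congr_fun ?_ hKcl.measurableSet
    intro x hx
    simp [hφ1 x hx]
  have hfKi : Integrable (K.indicator fun x => f (w x)) :=
    hfK.integrable_indicator hKcl.measurableSet
  set q : EuclideanSpace ℝ (Fin N) → ℝ≥0 := fun x => ‖K.indicator (fun x => f (w x)) x‖₊ with hq
  have hqm : AEMeasurable q := hfKi.1.aemeasurable.nnnorm
  have hqi : ∫⁻ x, q x < ∞ := hfKi.2
  obtain ⟨q', hqq', hq'm, hq'i⟩ := exists_lt_lowerSemicontinuous_lintegral_ge_of_aemeasurable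
    volume q hqm one_ne_zero
  have hq'i : ∫⁻ x, q' x < ∞ := hq'i.trans_lt (ENNReal.add_lt_top.2 ⟨hqi, ENNReal.one_lt_top⟩)
  have hq'm : Measurable q' := hq'm.measurable
  set P : EuclideanSpace ℝ (Fin N) → ℝ≥0∞ := fun x => ∫⁻ s in Icc 0 D, q' (x + s • e) with hP
  have hbound : ∀ x ∈ Ω, ‖Gfun f (w x)‖ₑ ≤ A + B + C * P x := by
    intro x hx
    have hxR : ‖x‖ < R := mem_ball_zero_iff.1 (hR hx)
    rcases le_or_gt 0 (w x) with h0 | h0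
    · exact (hBle x h0).trans (le_add_right (le_add_left le_rfl))
    rcases le_or_gt (-δ) (w x) with h1 | h1
    · refine le_trans ?_ (le_add_right (le_add_right le_rfl))
      refine (Gfun_enorm_le f _).trans (lintegral_mono_set ?_)
      rw [uIoc_of_ge h0.le, uIoc_of_ge (by linarith)]
      exact Ioc_subset_Ioc_left h1
    · have hγ : LipschitzWith C (fun s : ℝ => w (x + s • e)) := by
        have h2 : LipschitzWith 1 (fun s : ℝ => x + s • e) := by
          refine LipschitzWith.of_dist_le_mul fun a b => ?_
          rw [dist_add_left, dist_eq_norm, ← sub_smul, norm_smul, hen, mul_one, NNReal.coe_one,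
            one_mul, dist_eq_norm]
        simpa [Function.comp_def] using hC.comp h2
      have hγD : w (x + D • e) = 0 := by
        refine hw0 _ fun hmem => ?_
        have h2 := mem_ball_zero_iff.1 (hR hmem)
        have h3 : ‖D • e‖ ≤ ‖x + D • e‖ + ‖x‖ := by
          have := norm_sub_le (x + D • e) x
          rwa [add_sub_cancel_left] at this
        rw [norm_smul, hen, Real.norm_of_nonneg (by positivity)] at h3
        linarith
      have h3 := oned_ineq (fun y => ‖f y‖ₑ) hγ (D := D) (b := -δ) (by positivity)
        (by simp only [hγD]; linarith)
      simp only [zero_smul, add_zero] at h3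
      have h4 : ∫⁻ s in {s | s ∈ Icc 0 D ∧ w (x + s • e) ≤ -δ}, ‖f (w (x + s • e))‖ₑ ≤ P x := by
        have hSm : MeasurableSet {s | s ∈ Icc 0 D ∧ w (x + s • e) ≤ -δ} :=
          measurableSet_Icc.inter (hγ.continuous.measurable measurableSet_Iic)
        calc _ ≤ ∫⁻ s in {s | s ∈ Icc 0 D ∧ w (x + s • e) ≤ -δ}, q' (x + s • e) := by
              refine setLIntegral_mono' hSm fun s hs => ?_
              have hsK : x + s • e ∈ K := hs.2
              have := hqq' (x + s • e)
              simp only [hq, indicator_of_mem hsK] at this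
              exact this.le
          _ ≤ P x := lintegral_mono_set fun s hs => hs.1
      calc ‖Gfun f (w x)‖ₑ ≤ ∫⁻ s in uIoc 0 (w x), ‖f s‖ₑ := Gfun_enorm_le f _
        _ ≤ ∫⁻ s in uIoc 0 (-δ) ∪ Ioc (w x) (-δ), ‖f s‖ₑ := by
            refine lintegral_mono_set ?_
            rw [uIoc_of_ge h0.le, uIoc_of_ge (by linarith), union_comm,
              Ioc_union_Ioc_eq_Ioc h1.le (by linarith)]
        _ ≤ A + ∫⁻ s in Ioc (w x) (-δ), ‖f s‖ₑ := lintegral_union_le _ _ _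
        _ ≤ A + C * P x := by gcongr; exact h3.trans (by gcongr)
        _ ≤ A + B + C * P x := by gcongr; exact le_add_right le_rfl
  have hcm : Measurable fun p : EuclideanSpace ℝ (Fin N) × ℝ => q' (p.1 + p.2 • e) :=
    hq'm.comp (by fun_prop)
  have hPm : Measurable P := hcm.lintegral_prod_right'
  have hPi : ∫⁻ x in Ω, P x < ∞ := by
    refine (setLIntegral_le_lintegral _ _).trans_lt ?_
    rw [hP, lintegral_lintegral_swap hcm.aemeasurable]
    simp only [lintegral_add_right_eq_self]
    rw [lintegral_const, Measure.restrict_apply_univ]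
    exact ENNReal.mul_lt_top hq'i (by simp)
  refine (setLIntegral_mono' hΩo.measurableSet hbound).trans_lt ?_
  rw [lintegral_add_left measurable_const, lintegral_const, Measure.restrict_apply_univ,
    lintegral_const_mul _ hPm]
  exact ENNReal.add_lt_top.2 ⟨ENNReal.mul_lt_top (ENNReal.add_lt_top.2 ⟨hAt, hBt⟩) hΩfin,
    ENNReal.mul_lt_top (by simp) hPi⟩

set_option maxHeartbeats 800000 in
open scoped NNReal in
lemma diffeo_J {N : ℕ} {Ω : Set (EuclideanSpace ℝ (Fin N))} (hΩo : IsOpen Ω) (g f : ℝ → ℝ)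
    {w : EuclideanSpace ℝ (Fin N) → ℝ} (hw : ContDiff ℝ 1 w) (hw0 : ∀ x ∉ Ω, w x = 0)
    {φ : EuclideanSpace ℝ (Fin N) → ℝ} (hφ : ContDiff ℝ 1 φ) (hφΩ : tsupport φ ⊆ Ω)
    (e : EuclideanSpace ℝ (Fin N)) (he : ‖e‖ = 1) {L : ℝ≥0} (hL : LipschitzWith L φ)
    {t : ℝ} (ht : |t| * L < 1) :
    ∃ v : EuclideanSpace ℝ (Fin N) → ℝ, ContDiff ℝ 1 v ∧ (∀ x ∉ Ω, v x = 0) ∧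
      Jfun g f Ω v = ∫ x in Ω, (1 + t * fderiv ℝ φ x e) *
        (Gfun g ‖gradient w x - (t / (1 + t * fderiv ℝ φ x e) * fderiv ℝ w x e) • gradient φ x‖
          - Gfun f (w x)) := by
  have hb : ∀ x, 0 < 1 + t * fderiv ℝ φ x e := by
    intro x
    have h1 : |fderiv ℝ φ x e| ≤ L := by
      have h2 := (fderiv ℝ φ x).le_opNorm e
      rw [he, mul_one] at h2
      exact h2.trans (norm_fderiv_le_of_lipschitz ℝ hL)
    have h3 : |t * fderiv ℝ φ x e| < 1 := by
      rw [abs_mul]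
      exact (mul_le_mul_of_nonneg_left h1 (abs_nonneg t)).trans_lt ht
    linarith [(abs_lt.1 h3).1]
  set Ψ : EuclideanSpace ℝ (Fin N) → EuclideanSpace ℝ (Fin N) := fun x => x + (t * φ x) • e with hΨ
  have hΨc : ContDiff ℝ 1 Ψ :=
    contDiff_id.add ((contDiff_const.mul hφ).smul contDiff_const)
  set A : EuclideanSpace ℝ (Fin N) → EuclideanSpace ℝ (Fin N) →L[ℝ] EuclideanSpace ℝ (Fin N) :=
    fun x => ContinuousLinearMap.id ℝ _ + (t • fderiv ℝ φ x).smulRight e with hA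
  have hAa : ∀ x y, A x y = y + (t * fderiv ℝ φ x y) • e := fun x y => by
    simp [hA]
  have hΨd : ∀ x, HasFDerivAt Ψ (A x) x := by
    intro x
    have h1 : HasFDerivAt φ (fderiv ℝ φ x) x := (hφ.differentiable one_ne_zero x).hasFDerivAt
    exact (hasFDerivAt_id x).fun_add ((h1.const_mul t).smul_const e)
  set A' : EuclideanSpace ℝ (Fin N) → EuclideanSpace ℝ (Fin N) →L[ℝ] EuclideanSpace ℝ (Fin N) :=
    fun x => ContinuousLinearMap.id ℝ _ -
      ((t / (1 + t * fderiv ℝ φ x e)) • fderiv ℝ φ x).smulRight e with hA'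
  have hA'a : ∀ x y, A' x y = y - (t / (1 + t * fderiv ℝ φ x e) * fderiv ℝ φ x y) • e :=
    fun x y => by simp [hA']
  have hAA' : ∀ x y, A x (A' x y) = y := by
    intro x y
    have := (hb x).ne'
    rw [hAa, hA'a, map_sub, map_smul, sub_add, ← sub_smul, smul_eq_mul]
    have h0 : t / (1 + t * fderiv ℝ φ x e) * fderiv ℝ φ x y -
        t * (fderiv ℝ φ x y - t / (1 + t * fderiv ℝ φ x e) * fderiv ℝ φ x y * fderiv ℝ φ x e)
        = 0 := by
      field_simp
      ring
    rw [h0, zero_smul, sub_zero]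
  have hA'A : ∀ x y, A' x (A x y) = y := by
    intro x y
    have := (hb x).ne'
    rw [hAa, hA'a, map_add, map_smul, add_sub_assoc, ← sub_smul, smul_eq_mul]
    have h0 : t * fderiv ℝ φ x y - t / (1 + t * fderiv ℝ φ x e) *
        (fderiv ℝ φ x y + t * fderiv ℝ φ x y * fderiv ℝ φ x e) = 0 := by
      field_simp
      ring
    rw [h0, zero_smul, add_zero]
  have hnt : Nontrivial (EuclideanSpace ℝ (Fin N)) :=
    ⟨e, 0, fun h => by simp [h] at he⟩
  have happ : ApproximatesLinearOn Ψ
      ((ContinuousLinearEquiv.refl ℝ (EuclideanSpace ℝ (Fin N)) :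
        EuclideanSpace ℝ (Fin N) ≃L[ℝ] EuclideanSpace ℝ (Fin N)) :
        EuclideanSpace ℝ (Fin N) →L[ℝ] EuclideanSpace ℝ (Fin N)) univ (‖t‖₊ * L) := by
    intro x _ y _
    have h1 : Ψ x - Ψ y - (x - y) = (t * (φ x - φ y)) • e := by
      simp only [hΨ, mul_sub, sub_smul]
      abel
    have h2 := hL.dist_le_mul x y
    rw [Real.dist_eq, dist_eq_norm] at h2
    simp only [ContinuousLinearEquiv.coe_coe, ContinuousLinearEquiv.coe_refl', id]
    rw [h1, norm_smul, he, mul_one, norm_mul, NNReal.coe_mul, coe_nnnorm, mul_assoc,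
      Real.norm_eq_abs (φ x - φ y)]
    exact mul_le_mul_of_nonneg_left h2 (norm_nonneg _)
  have hlt : ‖t‖₊ * L < ‖((ContinuousLinearEquiv.refl ℝ (EuclideanSpace ℝ (Fin N))).symm :
      EuclideanSpace ℝ (Fin N) →L[ℝ] EuclideanSpace ℝ (Fin N))‖₊⁻¹ := by
    have h1 : ‖((ContinuousLinearEquiv.refl ℝ (EuclideanSpace ℝ (Fin N))).symm :
      EuclideanSpace ℝ (Fin N) →L[ℝ] EuclideanSpace ℝ (Fin N))‖₊ = 1 := by
      apply NNReal.eq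
      rw [coe_nnnorm]
      exact ContinuousLinearMap.norm_id
    rw [h1, inv_one, ← NNReal.coe_lt_coe]
    simpa using ht
  set H := ApproximatesLinearOn.toHomeomorph Ψ happ (Or.inr hlt) with hH
  have hHΨ : ∀ x, H x = Ψ x := fun x => rfl
  have hHs : ∀ x, H.symm (Ψ x) = x := fun x => by rw [← hHΨ, H.symm_apply_apply]
  have hsH : ∀ x, Ψ (H.symm x) = x := fun x => by rw [← hHΨ, H.apply_symm_apply]
  have hHsc : ContDiff ℝ 1 H.symm := by
    refine Homeomorph.contDiff_symm H (f₀' := fun x =>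
      ContinuousLinearEquiv.equivOfInverse (A x) (A' x) (hA'A x) (hAA' x)) (fun x => ?_) hΨc
    exact hΨd x
  have hout : ∀ x ∉ Ω, Ψ x = x := by
    intro x hx
    have : φ x = 0 := image_eq_zero_of_notMem_tsupport fun h => hx (hφΩ h)
    simp [hΨ, this]
  have hinj : Function.Injective Ψ := H.injective
  have himg : Ψ '' Ω = Ω := by
    apply Subset.antisymm
    · rintro _ ⟨x, hx, rfl⟩
      by_contra hn
      have := hinj (hout _ hn)
      rw [this] at hn
      exact hn hx
    · intro y hy
      refine ⟨H.symm y, ?_, hsH y⟩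
      by_contra hn
      have h1 := hout _ hn
      rw [hsH] at h1
      rw [← h1] at hn
      exact hn hy
  refine ⟨fun y => w (H.symm y), hw.comp hHsc, ?_, ?_⟩
  · intro x hx
    have : H.symm x = x := by
      conv_lhs => rw [← hout x hx]
      exact hHs x
    simp only [this, hw0 x hx]
  set v : EuclideanSpace ℝ (Fin N) → ℝ := fun y => w (H.symm y) with hv
  have hvc : ContDiff ℝ 1 v := hw.comp hHsc
  have hvw : ∀ x, v (Ψ x) = w x := fun x => by simp only [hv, hHs]
  have hfd : ∀ x y, fderiv ℝ v (Ψ x) y = fderiv ℝ w x y -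
      (t / (1 + t * fderiv ℝ φ x e) * fderiv ℝ w x e) * fderiv ℝ φ x y := by
    intro x y
    have h1 : HasFDerivAt (v ∘ Ψ) ((fderiv ℝ v (Ψ x)).comp (A x)) x :=
      ((hvc.differentiable one_ne_zero _).hasFDerivAt).comp x (hΨd x)
    have h2 : v ∘ Ψ = w := funext hvw
    rw [h2] at h1
    have h3 : fderiv ℝ w x (A' x y) = fderiv ℝ v (Ψ x) y := by
      rw [h1.fderiv, ContinuousLinearMap.comp_apply, hAA']
    rw [← h3, hA'a, map_sub, map_smul, smul_eq_mul]
    ring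
  have hgr : ∀ x, gradient v (Ψ x) = gradient w x -
      (t / (1 + t * fderiv ℝ φ x e) * fderiv ℝ w x e) • gradient φ x := by
    intro x
    refine ext_inner_right ℝ fun y => ?_
    rw [← fderiv_gradient, hfd, inner_sub_left, real_inner_smul_left, ← fderiv_gradient,
      ← fderiv_gradient]
  have hdet : ∀ x, (A x).det = 1 + t * fderiv ℝ φ x e := by
    intro x
    have h1 : ((A x : EuclideanSpace ℝ (Fin N) →L[ℝ] EuclideanSpace ℝ (Fin N)) :
        EuclideanSpace ℝ (Fin N) →ₗ[ℝ] EuclideanSpace ℝ (Fin N)) =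
        LinearMap.transvection ((t • fderiv ℝ φ x : EuclideanSpace ℝ (Fin N) →L[ℝ] ℝ) :
          EuclideanSpace ℝ (Fin N) →ₗ[ℝ] ℝ) e := by
      ext y
      simp [hAa, LinearMap.transvection]
    unfold ContinuousLinearMap.det
    rw [h1, LinearMap.transvection.det]
    simp
  unfold Jfun
  conv_lhs => rw [← himg]
  rw [integral_image_eq_integral_abs_det_fderiv_smul volume hΩo.measurableSet
    (fun x _ => (hΨd x).hasFDerivWithinAt) hinj.injOn]
  refine integral_congr_ae (Filter.Eventually.of_forall fun x => ?_)
  simp only [hdet, abs_of_pos (hb x), smul_eq_mul, hgr, hvw]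

set_option maxHeartbeats 1000000 in
lemma domvar {N : ℕ} {Ω : Set (EuclideanSpace ℝ (Fin N))} (hΩo : IsOpen Ω)
    (hΩb : IsBounded Ω) {g f : ℝ → ℝ} (hgc : ContinuousOn g (Ici 0))
    (hgm : StrictMonoOn g (Ici 0)) (hg0 : g 0 = 0)
    {w : EuclideanSpace ℝ (Fin N) → ℝ} (hw : ContDiff ℝ 1 w) (hw0 : ∀ x ∉ Ω, w x = 0)
    (hFi : Integrable (fun x => Gfun f (w x)))
    (hmin : ∀ v, ContDiff ℝ 1 v → (∀ x ∉ Ω, v x = 0) → Jfun g f Ω w ≤ Jfun g f Ω v)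
    (e : EuclideanSpace ℝ (Fin N)) (he : ‖e‖ = 1)
    (φ : EuclideanSpace ℝ (Fin N) → ℝ) (hφ : ContDiff ℝ 1 φ) (hφs : HasCompactSupport φ)
    (hφΩ : tsupport φ ⊆ Ω) :
    ∫ x, fderiv ℝ φ x ((Gfun g ‖gradient w x‖ - Gfun f (w x)) • e
      - (fderiv ℝ w x e) • gvec g (gradient w x)) = 0 := by
  have hws : HasCompactSupport w :=
    HasCompactSupport.intro hΩb.isCompact_closure fun x hx => hw0 x fun h => hx (subset_closure h)
  obtain ⟨L, hL⟩ := hφ.lipschitzWith_of_hasCompactSupport hφs one_ne_zero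
  obtain ⟨C, hC⟩ := hw.lipschitzWith_of_hasCompactSupport hws one_ne_zero
  set a : EuclideanSpace ℝ (Fin N) → ℝ := fun x => fderiv ℝ w x e with ha
  set b : EuclideanSpace ℝ (Fin N) → ℝ := fun x => fderiv ℝ φ x e with hb
  have hac : Continuous a := (hw.continuous_fderiv one_ne_zero).clm_apply continuous_const
  have hbc : Continuous b := (hφ.continuous_fderiv one_ne_zero).clm_apply continuous_const
  have hpc := gradient_continuous hw
  have hqc := gradient_continuous hφ
  have hpC : ∀ x, ‖gradient w x‖ ≤ C := fun x => by
    rw [norm_gradient]; exact norm_fderiv_le_of_lipschitz ℝ hC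
  have hqL : ∀ x, ‖gradient φ x‖ ≤ L := fun x => by
    rw [norm_gradient]; exact norm_fderiv_le_of_lipschitz ℝ hL
  have haC : ∀ x, |a x| ≤ C := fun x => by
    have h2 := (fderiv ℝ w x).le_opNorm e
    rw [he, mul_one] at h2
    exact h2.trans (norm_fderiv_le_of_lipschitz ℝ hC)
  have hbL : ∀ x, |b x| ≤ L := fun x => by
    have h2 := (fderiv ℝ φ x).le_opNorm e
    rw [he, mul_one] at h2
    exact h2.trans (norm_fderiv_le_of_lipschitz ℝ hL)
  -- time window
  have hL0 : (0:ℝ) ≤ L := L.2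
  have hC0 : (0:ℝ) ≤ C := C.2
  set ε : ℝ := 1 / (2 * (L + 1)) with hε
  have hε0 : 0 < ε := by positivity
  have hεL : ε * L ≤ 1 / 2 := by
    rw [hε]
    field_simp
    linarith
  have htb : ∀ t ∈ ball (0:ℝ) ε, |t| * L ≤ 1 / 2 := by
    intro t ht
    rw [mem_ball_zero_iff, Real.norm_eq_abs] at ht
    exact (mul_le_mul_of_nonneg_right ht.le hL0).trans hεL
  have hd : ∀ t ∈ ball (0:ℝ) ε, ∀ x, 1 / 2 ≤ 1 + t * b x := by
    intro t ht x
    have h1 : |t * b x| ≤ 1 / 2 := by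
      rw [abs_mul]
      exact (mul_le_mul_of_nonneg_left (hbL x) (abs_nonneg t)).trans (htb t ht)
    linarith [(abs_le.1 h1).1]
  set Gh : EuclideanSpace ℝ (Fin N) → ℝ := fun y => Gfun g ‖y‖ with hGh
  have hGd : ∀ y, HasFDerivAt Gh (innerSL ℝ (gvec g y)) y := Ghat_hasFDerivAt hgc hg0
  have hGc : Continuous Gh := continuous_iff_continuousAt.2 fun y => (hGd y).continuousAt
  have hvc : Continuous (gvec g : EuclideanSpace ℝ (Fin N) → EuclideanSpace ℝ (Fin N)) :=
    gvec_continuous hgc hgm hg0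
  obtain ⟨M1, hM1⟩ := (isCompact_closedBall (0 : EuclideanSpace ℝ (Fin N)) (2 * C)).exists_bound_of_continuousOn
    hGc.continuousOn
  obtain ⟨M2, hM2⟩ := (isCompact_closedBall (0 : EuclideanSpace ℝ (Fin N)) (2 * C)).exists_bound_of_continuousOn
    hvc.continuousOn
  set P : ℝ → EuclideanSpace ℝ (Fin N) → EuclideanSpace ℝ (Fin N) := fun t x =>
    gradient w x - (t / (1 + t * b x) * a x) • gradient φ x with hP
  have hPb : ∀ t ∈ ball (0:ℝ) ε, ∀ x, P t x ∈ closedBall (0 : EuclideanSpace ℝ (Fin N)) (2 * C) := by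
    intro t ht x
    rw [mem_closedBall_zero_iff]
    have h1 := hd t ht x
    have h2 : ‖(t / (1 + t * b x) * a x) • gradient φ x‖ ≤ C := by
      rw [norm_smul, norm_mul, norm_div, Real.norm_eq_abs, Real.norm_eq_abs, Real.norm_eq_abs,
        abs_of_pos (by linarith : 0 < 1 + t * b x)]
      have h3 : |t| / (1 + t * b x) ≤ 2 * |t| := by
        rw [div_le_iff₀ (by linarith)]
        nlinarith [abs_nonneg t]
      calc |t| / (1 + t * b x) * |a x| * ‖gradient φ x‖ ≤ (2 * |t|) * C * L := by
            gcongr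
            · exact haC x
            · exact hqL x
        _ = 2 * C * (|t| * L) := by ring
        _ ≤ 2 * C * (1 / 2) := by gcongr; exact htb t ht
        _ = C := by ring
    calc ‖P t x‖ ≤ ‖gradient w x‖ + ‖(t / (1 + t * b x) * a x) • gradient φ x‖ := norm_sub_le _ _
      _ ≤ 2 * C := by linarith [hpC x]
  set K : ℝ → EuclideanSpace ℝ (Fin N) → ℝ := fun t x =>
    (1 + t * b x) * (Gh (P t x) - Gfun f (w x)) with hK
  set K' : ℝ → EuclideanSpace ℝ (Fin N) → ℝ := fun t x =>
    b x * (Gh (P t x) - Gfun f (w x)) - a x / (1 + t * b x) * ⟪gvec g (P t x), gradient φ x⟫ with hK'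
  have hPc : ∀ t ∈ ball (0:ℝ) ε, Continuous (P t) := by
    intro t ht
    refine hpc.sub (Continuous.smul (Continuous.mul (Continuous.div continuous_const ?_ ?_) hac) hqc)
    · exact continuous_const.add (continuous_const.mul hbc)
    · intro x
      have := hd t ht x
      linarith
  have hfin : volume Ω < ⊤ := hΩb.measure_lt_top
  have : IsFiniteMeasure (volume.restrict Ω) := ⟨by rwa [Measure.restrict_apply_univ]⟩
  have h0m : (0:ℝ) ∈ ball (0:ℝ) ε := mem_ball_self hε0
  have hKm : ∀ t ∈ ball (0:ℝ) ε, AEStronglyMeasurable (K t) (volume.restrict Ω) := by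
    intro t ht
    refine AEStronglyMeasurable.mul ?_ (AEStronglyMeasurable.sub ?_ hFi.1.restrict)
    · exact (continuous_const.add (continuous_const.mul hbc)).aestronglyMeasurable
    · exact (hGc.comp (hPc t ht)).aestronglyMeasurable
  have hK'm : AEStronglyMeasurable (K' 0) (volume.restrict Ω) := by
    refine AEStronglyMeasurable.sub (AEStronglyMeasurable.mul hbc.aestronglyMeasurable
      (AEStronglyMeasurable.sub (hGc.comp (hPc 0 h0m)).aestronglyMeasurable hFi.1.restrict)) ?_
    refine Continuous.aestronglyMeasurable ?_
    refine Continuous.mul (hac.div ?_ ?_) ((hvc.comp (hPc 0 h0m)).inner hqc)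
    · exact continuous_const.add (continuous_const.mul hbc)
    · intro x
      simp
  have hK0i : Integrable (K 0) (volume.restrict Ω) := by
    refine Integrable.mono' (g := fun x => M1 + |Gfun f (w x)|)
      ((integrable_const M1).add hFi.abs.restrict) (hKm 0 h0m) (Filter.Eventually.of_forall fun x => ?_)
    simp only [hK, zero_mul, add_zero, one_mul]
    refine (norm_sub_le _ _).trans ?_
    exact add_le_add (hM1 _ (hPb 0 h0m x)) le_rfl
  have hK'b : ∀ x, ∀ t ∈ ball (0:ℝ) ε,
      ‖K' t x‖ ≤ L * (M1 + |Gfun f (w x)|) + 2 * C * (M2 * L) := by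
    intro x t ht
    have h1 := hd t ht x
    refine (norm_sub_le _ _).trans (add_le_add ?_ ?_)
    · rw [norm_mul]
      refine mul_le_mul (hbL x) ?_ (norm_nonneg _) hL0
      exact (norm_sub_le _ _).trans (add_le_add (hM1 _ (hPb t ht x)) le_rfl)
    · rw [norm_mul, norm_div, Real.norm_eq_abs, Real.norm_eq_abs,
        abs_of_pos (by linarith : 0 < 1 + t * b x)]
      have h3 : |a x| / (1 + t * b x) ≤ 2 * C := by
        rw [div_le_iff₀ (by linarith)]
        nlinarith [haC x]
      refine mul_le_mul h3 ?_ (norm_nonneg _) (by positivity)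
      refine (norm_inner_le_norm _ _).trans ?_
      exact mul_le_mul (hM2 _ (hPb t ht x)) (hqL x) (norm_nonneg _)
        ((norm_nonneg _).trans (hM2 _ (hPb t ht x)))
  have hKd : ∀ x, ∀ t ∈ ball (0:ℝ) ε, HasDerivAt (fun t => K t x) (K' t x) t := by
    intro x t ht
    have h1 : 0 < 1 + t * b x := by linarith [hd t ht x]
    have d1 : HasDerivAt (fun t : ℝ => 1 + t * b x) (b x) t := by
      simpa using ((hasDerivAt_id t).mul_const (b x)).const_add 1
    have d2 : HasDerivAt (fun t : ℝ => t / (1 + t * b x)) (1 / (1 + t * b x) ^ 2) t := by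
      have := (hasDerivAt_id t).div d1 h1.ne'
      refine this.congr_deriv ?_
      simp only [id]
      ring
    have d3 : HasDerivAt (fun t => P t x)
        (-((1 / (1 + t * b x) ^ 2 * a x) • gradient φ x)) t :=
      ((d2.mul_const (a x)).smul_const (gradient φ x)).const_sub (gradient w x)
    have d4 : HasDerivAt (fun t => Gh (P t x))
        (innerSL ℝ (gvec g (P t x)) (-((1 / (1 + t * b x) ^ 2 * a x) • gradient φ x))) t :=
      HasFDerivAt.comp_hasDerivAt (l := Gh) (f := fun t => P t x) t (hGd (P t x)) d3
    have d5 := d1.mul (d4.sub_const (Gfun f (w x)))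
    refine d5.congr_deriv ?_
    simp only [hK', innerSL_apply_apply, inner_neg_right, real_inner_smul_right]
    field_simp
    ring
  obtain ⟨-, hder⟩ := hasDerivAt_integral_of_dominated_loc_of_deriv_le (μ := volume.restrict Ω)
    (F := K) (F' := K') (x₀ := 0) (ball_mem_nhds (0:ℝ) hε0)
    (by filter_upwards [ball_mem_nhds (0:ℝ) hε0] with t ht using hKm t ht) hK0i hK'm
    (Filter.Eventually.of_forall hK'b)
    ((((integrable_const M1).add hFi.abs.restrict).const_mul _).add (integrable_const _))
    (Filter.Eventually.of_forall hKd)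
  have hJ0 : Jfun g f Ω w = ∫ x in Ω, K 0 x := by
    unfold Jfun
    simp [hK, hP, hGh]
  have hloc : IsLocalMin (fun t => ∫ x in Ω, K t x) 0 := by
    unfold IsLocalMin IsMinFilter
    filter_upwards [ball_mem_nhds (0:ℝ) hε0] with t ht
    obtain ⟨v, hv, hv0, hJ⟩ := diffeo_J hΩo g f hw hw0 hφ hφΩ e he hL (t := t)
      (by linarith [htb t ht])
    rw [← hJ0]
    refine (hmin v hv hv0).trans_eq ?_
    rw [hJ]
  have hz := hloc.hasDerivAt_eq_zero hder
  rw [← hz, ← setIntegral_eq_integral_of_forall_compl_eq_zero (s := Ω)]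
  · refine integral_congr_ae (Filter.Eventually.of_forall fun x => ?_)
    have hP0 : P 0 x = gradient w x := by simp [hP]
    simp only [hK', hP0, zero_mul, add_zero, div_one, map_sub, map_smul, smul_eq_mul]
    rw [fderiv_gradient φ x (gvec g (gradient w x)), real_inner_comm]
    simp only [hGh, hb, ha]
    ring
  · intro x hx
    have : fderiv ℝ φ x = 0 :=
      image_eq_zero_of_notMem_tsupport fun h => hx (hφΩ (tsupport_fderiv_subset ℝ h))
    rw [this, zero_apply]

/-- Lemma 4.1: a global minimizer of `J` in `X` solving the Euler–Lagrange equation and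
satisfying the homogeneous Neumann condition `∂u/∂ν = 0` on `∂Ω` vanishes identically. -/
theorem global_minimizer_neumann_trivial
    {N : ℕ} (hN : 1 ≤ N) (Ω : Set (EuclideanSpace ℝ (Fin N)))
    (hΩo : IsOpen Ω) (hΩconn : IsConnected Ω) (hΩb : IsBounded Ω) (hΩbd : HasC1Boundary Ω)
    (g f : ℝ → ℝ)
    (hgc : ContinuousOn g (Ici 0)) (hg1 : ContDiffOn ℝ 1 g (Ioi 0))
    (hgm : StrictMonoOn g (Ici 0)) (hg0 : g 0 = 0)
    (hfc : ContinuousOn f (Ici 0))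
    (u : EuclideanSpace ℝ (Fin N) → ℝ)
    (hmin : IsGlobalMinJ g f Ω u) (hsol : IsDistribSolAut Ω g f u)
    (hneu : NeumannZero Ω u) :
    ∀ x ∈ closure Ω, u x = 0 := by
  obtain ⟨hX, hmin⟩ := hmin
  set w : EuclideanSpace ℝ (Fin N) → ℝ := Ω.indicator u with hwd
  have hw : ContDiff ℝ 1 w := ext_contDiff hΩo hΩbd hX hneu
  have hw0 : ∀ x ∉ Ω, w x = 0 := fun x hx => indicator_of_notMem hx _
  have hwu : ∀ x ∈ Ω, w x = u x := fun x hx => indicator_of_mem hx _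
  have hwg : ∀ x ∉ Ω, gradient w x = 0 := by
    intro x hx
    unfold gradient
    rw [(ext_hasFDerivAt_zero hΩo hX hneu x hx).fderiv, map_zero]
  have hgu : ∀ x ∈ Ω, gradient w x = gradient u x := by
    intro x hx
    have : w =ᶠ[nhds x] u := by
      filter_upwards [hΩo.mem_nhds hx] with z hz using hwu z hz
    unfold gradient
    rw [this.fderiv_eq]
  have hJ : Jfun g f Ω w = Jfun g f Ω u := by
    refine setIntegral_congr_fun hΩo.measurableSet fun x hx => ?_
    simp only [hgu x hx, hwu x hx]
  have hmin' : ∀ v, ContDiff ℝ 1 v → (∀ x ∉ Ω, v x = 0) → Jfun g f Ω w ≤ Jfun g f Ω v := by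
    intro v hv hv0
    rw [hJ]
    refine hmin v ⟨hv.contDiffOn, fun x hx => hv0 x ?_⟩
    rw [hΩo.frontier_eq] at hx
    exact hx.2
  have hsol' : ∀ φ, IsTestFun Ω φ →
      (∫ x in Ω, ⟪gvec g (gradient w x), gradient φ x⟫) = ∫ x in Ω, f (w x) * φ x := by
    intro φ hφ
    have h1 := hsol φ hφ
    have h2 : (∫ x in Ω, ⟪gvec g (gradient w x), gradient φ x⟫) =
        ∫ x in Ω, ⟪gvec g (gradient u x), gradient φ x⟫ :=
      setIntegral_congr_fun hΩo.measurableSet fun x hx => by simp only [hgu x hx]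
    have h3 : (∫ x in Ω, f (w x) * φ x) = ∫ x in Ω, f (u x) * φ x :=
      setIntegral_congr_fun hΩo.measurableSet fun x hx => by simp only [hwu x hx]
    rw [h2, h3, h1]
  suffices hmain : ∀ x, w x = 0 by
    intro x hx
    by_cases hxΩ : x ∈ Ω
    · rw [← hwu x hxΩ, hmain]
    · exact hX.2 x (by rw [hΩo.frontier_eq]; exact ⟨hx, hxΩ⟩)
  have hvc : Continuous (gvec g : EuclideanSpace ℝ (Fin N) → EuclideanSpace ℝ (Fin N)) :=
    gvec_continuous hgc hgm hg0
  have hpc := gradient_continuous hw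
  by_cases hcase : ∀ φ, IsTestFun Ω φ → IntegrableOn (fun x => f (w x) * φ x) Ω
  swap
  · -- the right-hand side is never integrable enough: the equation becomes homogeneous
    push Not at hcase
    obtain ⟨φ₀, hφ₀, hni⟩ := hcase
    have hz : ∀ φ, IsTestFun Ω φ → ¬ IntegrableOn (fun x => f (w x) * φ x) Ω →
        (∫ x in Ω, ⟪gvec g (gradient w x), gradient φ x⟫) = 0 := by
      intro φ hφ hn
      rw [hsol' φ hφ]
      exact integral_undef hn
    have hint : ∀ φ, IsTestFun Ω φ →
        IntegrableOn (fun x => ⟪gvec g (gradient w x), gradient φ x⟫) Ω := by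
      intro φ hφ
      have hφ1 : ContDiff ℝ 1 φ := hφ.1.of_le (by exact_mod_cast le_top)
      have hc : Continuous fun x => ⟪gvec g (gradient w x), gradient φ x⟫ :=
        (hvc.comp hpc).inner (gradient_continuous hφ1)
      exact (hc.continuousOn.integrableOn_compact hΩb.isCompact_closure).mono_set subset_closure
    refine case_one hN hΩo hΩb hΩbd hgc hgm hg0 hw hw0 hwg ?_
    intro ψ hψ
    by_cases hψi : IntegrableOn (fun x => f (w x) * ψ x) Ω
    swap
    · exact hz ψ hψ hψi
    have hsum : IsTestFun Ω (fun x => φ₀ x + ψ x) := by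
      refine ⟨hφ₀.1.add hψ.1, hφ₀.2.1.add hψ.2.1, ?_⟩
      exact (tsupport_add φ₀ ψ).trans (union_subset hφ₀.2.2 hψ.2.2)
    have hsn : ¬ IntegrableOn (fun x => f (w x) * (φ₀ x + ψ x)) Ω := by
      intro hs
      apply hni
      refine (hs.sub hψi).congr (Filter.Eventually.of_forall fun x => ?_)
      simp only [Pi.sub_apply]
      ring
    have h1 := hz _ hsum hsn
    have h2 := hz _ hφ₀ hni
    have hd : ∀ φ, IsTestFun Ω φ → Differentiable ℝ φ := fun φ hφ =>
      hφ.1.differentiable (by simp)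
    have h3 : ∀ x, gradient (fun x => φ₀ x + ψ x) x = gradient φ₀ x + gradient ψ x := by
      intro x
      unfold gradient
      rw [fderiv_fun_add (hd _ hφ₀ x) (hd _ hψ x), map_add]
    simp only [h3, inner_add_right] at h1
    rw [integral_add (hint _ hφ₀) (hint _ hψ), h2, zero_add] at h1
    exact h1
  have hFi : Integrable (fun x => Gfun f (w x)) := F_integrable hN hΩo hΩb hfc hw hw0 hcase
  set e : EuclideanSpace ℝ (Fin N) := EuclideanSpace.single ⟨0, hN⟩ 1 with he
  have hen : ‖e‖ = 1 := by simp [he]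
  have hGc : Continuous fun y : EuclideanSpace ℝ (Fin N) => Gfun g ‖y‖ :=
    continuous_iff_continuousAt.2 fun y => (Ghat_hasFDerivAt hgc hg0 y).continuousAt
  set a : EuclideanSpace ℝ (Fin N) → ℝ := fun x => fderiv ℝ w x e with ha
  have hac : Continuous a := (hw.continuous_fderiv one_ne_zero).clm_apply continuous_const
  have ha0 : ∀ x ∉ Ω, a x = 0 := fun x hx => by
    simp only [ha, fderiv_gradient, hwg x hx, inner_zero_left]
  have hF0 : Gfun f 0 = 0 := by simp [Gfun]
  have hG0 : Gfun g 0 = 0 := by simp [Gfun]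
  have hGs : HasCompactSupport fun x => Gfun g ‖gradient w x‖ :=
    HasCompactSupport.intro hΩb.isCompact_closure fun x hx => by
      rw [hwg x fun h => hx (subset_closure h), norm_zero, hG0]
  have hGi : Integrable fun x => Gfun g ‖gradient w x‖ :=
    (hGc.comp hpc).integrable_of_hasCompactSupport hGs
  have hSc : Continuous fun x => a x • gvec g (gradient w x) := hac.smul (hvc.comp hpc)
  have hSs : HasCompactSupport fun x => a x • gvec g (gradient w x) :=
    HasCompactSupport.intro hΩb.isCompact_closure fun x hx => by
      rw [ha0 x fun h => hx (subset_closure h), zero_smul]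
  have hSi : Integrable fun x => a x • gvec g (gradient w x) :=
    hSc.integrable_of_hasCompactSupport hSs
  set T : EuclideanSpace ℝ (Fin N) → EuclideanSpace ℝ (Fin N) := fun x =>
    (Gfun g ‖gradient w x‖ - Gfun f (w x)) • e - a x • gvec g (gradient w x) with hT
  have hTi : Integrable T := ((hGi.sub hFi).smul_const e).sub hSi
  have hT0 : ∀ x ∉ Ω, T x = 0 := by
    intro x hx
    simp only [hT, hwg x hx, hw0 x hx, ha0 x hx, norm_zero, hG0, hF0, sub_zero, zero_smul]
  have hTc : ∀ x ∈ frontier Ω, ContinuousAt T x := by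
    intro x hx
    have hxn : x ∉ Ω := by
      rw [hΩo.frontier_eq] at hx
      exact hx.2
    have hFc : ContinuousAt (fun x => Gfun f (w x)) x := by
      refine ContinuousAt.comp (g := Gfun f) (f := w) ?_ hw.continuous.continuousAt
      rw [hw0 x hxn]
      exact Gfun_continuousAt_zero hfc
    exact (((hGc.comp hpc).continuousAt.sub hFc).smul continuousAt_const).sub hSc.continuousAt
  have hfin := bdry_global hΩo hΩb hΩbd hTi hT0 hTc
    (fun φ h1 h2 h3 => domvar hΩo hΩb hgc hgm hg0 hw hw0 hFi hmin' e hen φ h1 h2 h3)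
    (fun x => ⟪e, x⟫) (innerSL ℝ e).contDiff
  have hfd : ∀ x, fderiv ℝ (fun x : EuclideanSpace ℝ (Fin N) => ⟪e, x⟫) x = innerSL ℝ e :=
    fun x => (innerSL ℝ e).hasFDerivAt.fderiv
  have hTe : ∀ x, fderiv ℝ (fun x : EuclideanSpace ℝ (Fin N) => ⟪e, x⟫) x (T x) =
      (Gfun g ‖gradient w x‖ - Gfun f (w x)) -
        ⟪gradient w x, e⟫ * ⟪gvec g (gradient w x), e⟫ := by
    intro x
    rw [hfd, innerSL_apply_apply]
    simp only [hT, inner_sub_right, real_inner_smul_right, real_inner_self_eq_norm_sq, hen, ha,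
      fderiv_gradient, real_inner_comm e]
    ring
  simp only [hTe] at hfin
  have hQc : Continuous fun x => ⟪gradient w x, e⟫ * ⟪gvec g (gradient w x), e⟫ :=
    (hpc.inner continuous_const).mul ((hvc.comp hpc).inner continuous_const)
  have hQs : HasCompactSupport fun x => ⟪gradient w x, e⟫ * ⟪gvec g (gradient w x), e⟫ :=
    HasCompactSupport.intro hΩb.isCompact_closure fun x hx => by
      rw [hwg x fun h => hx (subset_closure h), inner_zero_left, zero_mul]
  have hQi := hQc.integrable_of_hasCompactSupport hQs (μ := volume)
  have hGF : Integrable (fun x => Gfun g ‖gradient w x‖ - Gfun f (w x)) := hGi.sub hFi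
  rw [integral_sub hGF hQi] at hfin
  have hJw : Jfun g f Ω w = ∫ x, (Gfun g ‖gradient w x‖ - Gfun f (w x)) := by
    refine setIntegral_eq_integral_of_forall_compl_eq_zero fun x hx => ?_
    simp only [hwg x hx, hw0 x hx, norm_zero, hG0, hF0, sub_zero]
  have hJ0 : Jfun g f Ω w ≤ 0 := by
    refine (hmin' (fun _ => 0) contDiff_const fun _ _ => rfl).trans_eq ?_
    unfold Jfun
    have : ∀ x : EuclideanSpace ℝ (Fin N),
        gradient (fun _ : EuclideanSpace ℝ (Fin N) => (0:ℝ)) x = 0 := by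
      intro x
      unfold gradient
      simp
    simp [this, hG0, hF0]
  have hQnn : ∀ x, 0 ≤ ⟪gradient w x, e⟫ * ⟪gvec g (gradient w x), e⟫ := fun x =>
    gvec_inner_nonneg_aux hgm hg0 _ _
  have hQ0 : ∫ x, ⟪gradient w x, e⟫ * ⟪gvec g (gradient w x), e⟫ = 0 := by
    have h1 : 0 ≤ ∫ x, ⟪gradient w x, e⟫ * ⟪gvec g (gradient w x), e⟫ := integral_nonneg hQnn
    rw [hJw] at hJ0
    have hfin' : (∫ x, (Gfun g ‖gradient w x‖ - Gfun f (w x))) -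
      (∫ x, ⟪gradient w x, e⟫ * ⟪gvec g (gradient w x), e⟫) = 0 := hfin
    linarith
  have hQz : (fun x => ⟪gradient w x, e⟫ * ⟪gvec g (gradient w x), e⟫) = fun _ => 0 :=
    (hQc.ae_eq_iff_eq volume continuous_const).1 ((integral_eq_zero_iff_of_nonneg hQnn hQi).1 hQ0)
  refine zero_of_dir hΩb hw hw0 e hen fun x => ?_
  rw [fderiv_gradient]
  exact gvec_inner_zero_aux hgm hg0 _ _ (congrFun hQz x)
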